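/- For any x₀ ≤ 0, there exists a unique real solution of y'' = 6y² − x whose interval of existence is exactly (X(x₀), x₀), where X(x₀) is the infimum of left blow-up points over all solutions regular at x₀. -/

import Mathlib

open Filter Set Topology

namespace PainleveI

lemma monotoneOn_of_hasDerivAt_nonneg {I : Set ℝ} (hI : Convex ℝ I) {f f' : ℝ → ℝ}
    (h : ∀ t ∈ I, HasDerivAt f (f' t) t) (h0 : ∀ t ∈ I, 0 ≤ f' t) : MonotoneOn f I :=
  monotoneOn_of_hasDerivWithinAt_nonneg hI
    (fun t ht => (h t ht).continuousAt.continuousWithinAt)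
    (fun t ht => (h t (interior_subset ht)).hasDerivWithinAt)
    (fun t ht => h0 t (interior_subset ht))

/-- Gronwall estimate for second order scalar equations. -/
lemma gronwall_second_order {a b K : ℝ} {Y₁ V₁ A₁ Y₂ V₂ A₂ : ℝ → ℝ}
    (hK : 0 ≤ K)
    (h₁ : ∀ t ∈ Icc a b, HasDerivAt Y₁ (V₁ t) t ∧ HasDerivAt V₁ (A₁ t) t)
    (h₂ : ∀ t ∈ Icc a b, HasDerivAt Y₂ (V₂ t) t ∧ HasDerivAt V₂ (A₂ t) t)
    (hL : ∀ t ∈ Icc a b, |A₁ t - A₂ t| ≤ K * |Y₁ t - Y₂ t|) {t₀ t : ℝ}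
    (ht₀ : t₀ ∈ Icc a b) (ht : t ∈ Icc a b) :
    (Y₁ t - Y₂ t) ^ 2 + (V₁ t - V₂ t) ^ 2 ≤
      ((Y₁ t₀ - Y₂ t₀) ^ 2 + (V₁ t₀ - V₂ t₀) ^ 2) * Real.exp ((1 + K) * |t - t₀|) := by
  set e : ℝ → ℝ := fun s => (Y₁ s - Y₂ s) ^ 2 + (V₁ s - V₂ s) ^ 2 with he
  set e' : ℝ → ℝ := fun s => 2 * (Y₁ s - Y₂ s) * (V₁ s - V₂ s) +
    2 * (V₁ s - V₂ s) * (A₁ s - A₂ s) with he'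
  have hd : ∀ s ∈ Icc a b, HasDerivAt e (e' s) s := by
    intro s hs
    have := (((h₁ s hs).1.sub (h₂ s hs).1).pow 2).add (((h₁ s hs).2.sub (h₂ s hs).2).pow 2)
    refine this.congr_deriv ?_
    simp [he']
  have hb : ∀ s ∈ Icc a b, |e' s| ≤ (1 + K) * e s := by
    intro s hs
    have h3 := hL s hs
    simp only [he, he']
    have k1 : |2 * (Y₁ s - Y₂ s) * (V₁ s - V₂ s) + 2 * (V₁ s - V₂ s) * (A₁ s - A₂ s)| ≤
        2 * |Y₁ s - Y₂ s| * |V₁ s - V₂ s| + 2 * |V₁ s - V₂ s| * |A₁ s - A₂ s| := by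
      refine (abs_add_le _ _).trans (le_of_eq ?_)
      simp [abs_mul]
    rw [← sq_abs (Y₁ s - Y₂ s), ← sq_abs (V₁ s - V₂ s)]
    generalize |Y₁ s - Y₂ s| = p at *
    generalize hq : |V₁ s - V₂ s| = r at *
    generalize |A₁ s - A₂ s| = z at *
    have hr : 0 ≤ r := hq ▸ abs_nonneg _
    have : r * z ≤ r * (K * p) := mul_le_mul_of_nonneg_left h3 hr
    nlinarith [mul_nonneg hK (sq_nonneg (p - r)), sq_nonneg (p - r)]
  have hexp : ∀ c s : ℝ, HasDerivAt (fun u => Real.exp (c * (u - t₀)))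
      (Real.exp (c * (s - t₀)) * c) s := fun c s => by
    have := (((hasDerivAt_id s).sub_const t₀).const_mul c).exp
    simpa using this
  rcases le_total t₀ t with hle | hle
  · have hmono := monotoneOn_of_hasDerivAt_nonneg (convex_Icc a b)
      (f := fun s => -(e s * Real.exp (-(1 + K) * (s - t₀))))
      (fun s hs => ((hd s hs).mul (hexp (-(1 + K)) s)).neg)
      (fun s hs => by
        have h1 := (abs_le.1 (hb s hs)).2
        have h2 := Real.exp_pos (-(1 + K) * (s - t₀))
        nlinarith) ht₀ ht hle
    simp only [sub_self, mul_zero, Real.exp_zero, mul_one, neg_le_neg_iff] at hmono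
    rw [abs_of_nonneg (sub_nonneg.2 hle)]
    have h3 := mul_le_mul_of_nonneg_right hmono (Real.exp_pos ((1 + K) * (t - t₀))).le
    rwa [mul_assoc, ← Real.exp_add, show -(1 + K) * (t - t₀) + (1 + K) * (t - t₀) = 0 by ring,
      Real.exp_zero, mul_one] at h3
  · have hmono := monotoneOn_of_hasDerivAt_nonneg (convex_Icc a b)
      (f := fun s => e s * Real.exp ((1 + K) * (s - t₀)))
      (fun s hs => (hd s hs).mul (hexp (1 + K) s))
      (fun s hs => by
        have h1 := (abs_le.1 (hb s hs)).1
        have h2 := Real.exp_pos ((1 + K) * (s - t₀))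
        nlinarith) ht ht₀ hle
    simp only [sub_self, mul_zero, Real.exp_zero, mul_one] at hmono
    rw [abs_of_nonpos (sub_nonpos.2 hle)]
    have h3 := mul_le_mul_of_nonneg_right hmono (Real.exp_pos ((1 + K) * (-(t - t₀)))).le
    rwa [mul_assoc, ← Real.exp_add, show (1 + K) * (t - t₀) + (1 + K) * -(t - t₀) = 0 by ring,
      Real.exp_zero, mul_one] at h3

/-- Global existence for `y'' = g(t, y)` with `g` bounded and Lipschitz in `y`. -/
lemma exists_solution_of_bounded_lipschitz {g : ℝ → ℝ → ℝ} {a b B : ℝ} {K : NNReal}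
    (hg : ∀ y, Continuous fun t => g t y) (hL : ∀ t ∈ Icc a b, LipschitzWith K (g t))
    (hB : ∀ t ∈ Icc a b, ∀ y, |g t y| ≤ B) {t₀ : ℝ} (ht₀ : t₀ ∈ Ioo a b) (y₀ v₀ : ℝ) :
    ∃ Y V : ℝ → ℝ, Y t₀ = y₀ ∧ V t₀ = v₀ ∧
      ∀ t ∈ Ioo a b, HasDerivAt Y (V t) t ∧ HasDerivAt V (g t (Y t)) t := by
  have hT : 0 < b - a := by linarith [ht₀.1, ht₀.2]
  set T := b - a with hTdef
  have hB0 : 0 ≤ B := (abs_nonneg _).trans (hB t₀ ⟨ht₀.1.le, ht₀.2.le⟩ 0)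
  set κ : ℝ := 1 / (2 * T) with hκ
  have hκ0 : 0 < κ := by positivity
  set R : ℝ := 2 * |v₀| * T + 4 * B * T ^ 2 with hR
  have hR0 : 0 ≤ R := by positivity
  set L : ℝ := |v₀| + κ * R + B / κ with hLdef
  have hL0 : 0 ≤ L := by positivity
  have hκT : κ * T = 1 / 2 := by rw [hκ]; field_simp
  have hLT : L * T = R := by
    have : B / κ = 2 * T * B := by rw [hκ]; field_simp
    rw [hLdef, this]
    nlinarith
  let f : ℝ → ℝ × ℝ → ℝ × ℝ := fun t p => (κ * p.2, g t p.1 / κ)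
  let x₀ : ℝ × ℝ := (y₀, v₀ / κ)
  have hPL : IsPicardLindelof f (tmin := a) (tmax := b) ⟨t₀, ht₀.1.le, ht₀.2.le⟩ x₀
      ⟨R, hR0⟩ 0 ⟨L, hL0⟩ (⟨κ, hκ0.le⟩ + K / ⟨κ, hκ0.le⟩) := by
    refine ⟨?_, ?_, ?_, ?_⟩
    · intro t ht
      refine LipschitzWith.lipschitzOnWith ?_
      refine LipschitzWith.of_dist_le_mul fun p p' => ?_
      have h1 : dist p.1 p'.1 ≤ dist p p' := by rw [Prod.dist_eq]; exact le_max_left _ _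
      have h2 : dist p.2 p'.2 ≤ dist p p' := by rw [Prod.dist_eq]; exact le_max_right _ _
      have h3 := (hL t ht).dist_le_mul p.1 p'.1
      rw [Prod.dist_eq]
      have hc : ((⟨κ, hκ0.le⟩ + K / ⟨κ, hκ0.le⟩ : NNReal) : ℝ) = κ + K / κ := by
        rfl
      rw [hc]
      have h4 : dist (κ * p.2) (κ * p'.2) = κ * dist p.2 p'.2 := by
        rw [Real.dist_eq, Real.dist_eq, ← mul_sub, abs_mul, abs_of_pos hκ0]
      have h5 : dist (g t p.1 / κ) (g t p'.1 / κ) = dist (g t p.1) (g t p'.1) / κ := by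
        rw [Real.dist_eq, Real.dist_eq, ← sub_div, abs_div, abs_of_pos hκ0]
      have hd0 : 0 ≤ dist p p' := dist_nonneg
      have hK0 : (0 : ℝ) ≤ K := K.2
      refine max_le ?_ ?_
      · change dist (κ * p.2) (κ * p'.2) ≤ _
        rw [h4, add_mul]
        have : 0 ≤ K / κ * dist p p' := by positivity
        nlinarith
      · change dist (g t p.1 / κ) (g t p'.1 / κ) ≤ _
        rw [h5, add_mul]
        have h6 : dist (g t p.1) (g t p'.1) / κ ≤ K * dist p p' / κ := by
          gcongr
          exact h3.trans (by gcongr)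
        have h7 : K * dist p p' / κ = K / κ * dist p p' := by ring
        have : 0 ≤ κ * dist p p' := by positivity
        linarith
    · intro p _
      exact (continuous_const.prodMk ((hg p.1).div_const κ)).continuousOn
    · intro t ht p hp
      have hp2 : |p.2 - v₀ / κ| ≤ R := by
        have h1 : dist p.2 x₀.2 ≤ dist p x₀ := by rw [Prod.dist_eq]; exact le_max_right _ _
        exact h1.trans hp
      have hp3 : κ * |p.2| ≤ |v₀| + κ * R := by
        have : |p.2| ≤ |p.2 - v₀ / κ| + |v₀ / κ| := by
          simpa using abs_add_le (p.2 - v₀ / κ) (v₀ / κ)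
        have h8 : |v₀ / κ| = |v₀| / κ := by rw [abs_div, abs_of_pos hκ0]
        have h9 : κ * (|v₀| / κ) = |v₀| := by field_simp
        rw [h8] at this
        nlinarith
      rw [Prod.norm_def]
      refine max_le ?_ ?_
      · change ‖κ * p.2‖ ≤ L
        rw [Real.norm_eq_abs, abs_mul, abs_of_pos hκ0]
        have : 0 ≤ B / κ := by positivity
        linarith
      · change ‖g t p.1 / κ‖ ≤ L
        rw [Real.norm_eq_abs, abs_div, abs_of_pos hκ0]
        have h1 : |g t p.1| / κ ≤ B / κ := by gcongr; exact hB t ht _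
        have : 0 ≤ |v₀| + κ * R := by positivity
        linarith
    · change L * max (b - t₀) (t₀ - a) ≤ R - 0
      rw [sub_zero, ← hLT]
      gcongr
      exact max_le (by linarith [ht₀.1]) (by linarith [ht₀.2])
  obtain ⟨α, hα0, hα⟩ := hPL.exists_eq_forall_mem_Icc_hasDerivWithinAt₀
  change α t₀ = x₀ at hα0
  refine ⟨fun t => (α t).1, fun t => κ * (α t).2, by simp [hα0, x₀],
    by simp only [hα0, x₀]; field_simp, fun t ht => ?_⟩
  have h := (hα t ⟨ht.1.le, ht.2.le⟩).hasDerivAt (Icc_mem_nhds ht.1 ht.2)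
  have h1 : HasDerivAt (fun t => (α t).1) (f t (α t)).1 t :=
    (hasFDerivAt_fst (𝕜 := ℝ) (p := α t)).comp_hasDerivAt t h
  have h2 : HasDerivAt (fun t => (α t).2) (f t (α t)).2 t :=
    (hasFDerivAt_snd (𝕜 := ℝ) (p := α t)).comp_hasDerivAt t h
  refine ⟨h1, (h2.const_mul κ).congr_deriv ?_⟩
  simp only [f]
  field_simp

/-- `(Y, V)` solves `Y' = V`, `V' = 6 Y ^ 2 + q` at every point of `I`. -/
def IsSol (q : ℝ → ℝ) (I : Set ℝ) (Y V : ℝ → ℝ) : Prop :=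
  ∀ t ∈ I, HasDerivAt Y (V t) t ∧ HasDerivAt V (6 * Y t ^ 2 + q t) t

lemma IsSol.mono {q : ℝ → ℝ} {I J : Set ℝ} {Y V : ℝ → ℝ} (h : IsSol q I Y V) (hJ : J ⊆ I) :
    IsSol q J Y V := fun t ht => h t (hJ ht)

lemma IsSol.reflect {q : ℝ → ℝ} {I J : Set ℝ} {Y V : ℝ → ℝ} (h : IsSol q I Y V)
    (hJ : ∀ t ∈ J, -t ∈ I) :
    IsSol (fun t => q (-t)) J (fun t => Y (-t)) (fun t => -V (-t)) := by
  intro t ht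
  obtain ⟨h1, h2⟩ := h (-t) (hJ t ht)
  refine ⟨?_, ?_⟩
  · exact (h1.scomp t (hasDerivAt_neg t)).congr_deriv (by simp)
  · exact (h2.scomp t (hasDerivAt_neg t)).neg.congr_deriv (by simp)

lemma IsSol.continuousOn {q : ℝ → ℝ} {I : Set ℝ} {Y V : ℝ → ℝ} (h : IsSol q I Y V) :
    ContinuousOn Y I := fun t ht => (h t ht).1.continuousAt.continuousWithinAt

lemma IsSol.continuousOn_deriv {q : ℝ → ℝ} {I : Set ℝ} {Y V : ℝ → ℝ} (h : IsSol q I Y V) :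
    ContinuousOn V I := fun t ht => (h t ht).2.continuousAt.continuousWithinAt

lemma IsSol.monotoneOn_deriv {q : ℝ → ℝ} {I : Set ℝ} {Y V : ℝ → ℝ} (h : IsSol q I Y V)
    (hI : Convex ℝ I) (hq : ∀ t ∈ I, 0 ≤ q t) : MonotoneOn V I :=
  monotoneOn_of_hasDerivAt_nonneg hI (fun t ht => (h t ht).2)
    (fun t ht => by have := hq t ht; positivity)

/-- Truncation of `y` to the band between `lo t` and `M`. -/
def trunc (lo : ℝ → ℝ) (M t y : ℝ) : ℝ := max (lo t) (min y M)

lemma abs_trunc_le {lo : ℝ → ℝ} {M : ℝ} (hlo : ∀ t, |lo t| ≤ M) (t y : ℝ) :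
    |trunc lo M t y| ≤ M := by
  have h := abs_le.1 (hlo t)
  exact abs_le.2 ⟨h.1.trans (le_max_left _ _), max_le h.2 (min_le_right _ _)⟩

lemma abs_trunc_sub_le (lo : ℝ → ℝ) (M t y z : ℝ) :
    |trunc lo M t y - trunc lo M t z| ≤ |y - z| := by
  have h := ((LipschitzWith.id (α := ℝ)).min_const M).const_max (lo t)
  simpa [Real.dist_eq, trunc] using h.dist_le_mul y z

lemma abs_trunc_sq_sub_le {lo : ℝ → ℝ} {M : ℝ} (hlo : ∀ t, |lo t| ≤ M) (t y z c : ℝ) :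
    |6 * trunc lo M t y ^ 2 + c - (6 * trunc lo M t z ^ 2 + c)| ≤ 12 * M * |y - z| := by
  have h1 := abs_trunc_le hlo t y
  have h2 := abs_trunc_le hlo t z
  have h3 := abs_trunc_sub_le lo M t y z
  have h4 : 6 * trunc lo M t y ^ 2 + c - (6 * trunc lo M t z ^ 2 + c) =
    6 * (trunc lo M t y + trunc lo M t z) * (trunc lo M t y - trunc lo M t z) := by ring
  rw [h4, abs_mul, abs_mul, abs_of_pos (by norm_num : (0 : ℝ) < 6)]
  have h5 : |trunc lo M t y + trunc lo M t z| ≤ 2 * M :=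
    (abs_add_le _ _).trans (by linarith)
  have hM : 0 ≤ M := (abs_nonneg _).trans h1
  calc _ ≤ 6 * (2 * M) * |y - z| := by gcongr
    _ = _ := by ring

lemma trunc_eq_self {lo : ℝ → ℝ} {M t y : ℝ} (h1 : lo t ≤ y) (h2 : y ≤ M) :
    trunc lo M t y = y := by
  rw [trunc, min_eq_left h2, max_eq_right h1]

lemma exists_trunc_solution {q lo : ℝ → ℝ} (hq : Continuous q) (hlo : Continuous lo) {M : ℝ}
    (hM : ∀ t, |lo t| ≤ M) {a b t₀ : ℝ} (ht₀ : t₀ ∈ Ioo a b) (y₀ v₀ : ℝ) :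
    ∃ Y V : ℝ → ℝ, Y t₀ = y₀ ∧ V t₀ = v₀ ∧ ∀ t ∈ Ioo a b,
      HasDerivAt Y (V t) t ∧ HasDerivAt V (6 * trunc lo M t (Y t) ^ 2 + q t) t := by
  obtain ⟨Q, hQ⟩ := isCompact_Icc.exists_bound_of_continuousOn (hq.continuousOn (s := Icc a b))
  have hM0 : 0 ≤ M := (abs_nonneg _).trans (hM 0)
  refine exists_solution_of_bounded_lipschitz (g := fun t y => 6 * trunc lo M t y ^ 2 + q t)
    (B := 6 * M ^ 2 + Q) (K := ⟨12 * M, by positivity⟩) ?_ ?_ ?_ ht₀ y₀ v₀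
  · intro y
    unfold trunc
    fun_prop
  · intro t _
    refine LipschitzWith.of_dist_le_mul fun y z => ?_
    rw [Real.dist_eq, Real.dist_eq]
    exact abs_trunc_sq_sub_le hM t y z (q t)
  · intro t ht y
    refine (abs_add_le _ _).trans (add_le_add ?_ (hQ t ht))
    rw [abs_of_nonneg (by positivity), ← sq_abs]
    have := abs_trunc_le hM t y
    gcongr

lemma IsSol.gronwall_trunc {q Y V Z W : ℝ → ℝ} {a b N : ℝ} (h : IsSol q (Icc a b) Y V)
    (hN : ∀ t ∈ Icc a b, |Y t| ≤ N)
    (h' : ∀ t ∈ Icc a b, HasDerivAt Z (W t) t ∧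
      HasDerivAt W (6 * trunc (fun _ => -N) N t (Z t) ^ 2 + q t) t)
    {t₀ t : ℝ} (ht₀ : t₀ ∈ Icc a b) (ht : t ∈ Icc a b) :
    (Y t - Z t) ^ 2 + (V t - W t) ^ 2 ≤
      ((Y t₀ - Z t₀) ^ 2 + (V t₀ - W t₀) ^ 2) * Real.exp ((1 + 12 * N) * |t - t₀|) := by
  have hN0 : 0 ≤ N := (abs_nonneg _).trans (hN t₀ ht₀)
  refine gronwall_second_order (by positivity) h h' (fun s hs => ?_) ht₀ ht
  have h1 := abs_le.1 (hN s hs)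
  nth_rw 1 [← trunc_eq_self (lo := fun _ => -N) (t := s) h1.1 h1.2]
  exact abs_trunc_sq_sub_le (fun _ => by rw [abs_neg, abs_of_nonneg hN0]) s _ _ _

lemma IsSol.eq_trunc {q Y V Z W : ℝ → ℝ} {a b N : ℝ} (h : IsSol q (Icc a b) Y V)
    (hN : ∀ t ∈ Icc a b, |Y t| ≤ N)
    (h' : ∀ t ∈ Icc a b, HasDerivAt Z (W t) t ∧
      HasDerivAt W (6 * trunc (fun _ => -N) N t (Z t) ^ 2 + q t) t)
    {t₀ t : ℝ} (ht₀ : t₀ ∈ Icc a b) (ht : t ∈ Icc a b) (hy : Y t₀ = Z t₀) (hv : V t₀ = W t₀) :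
    Y t = Z t ∧ V t = W t := by
  have h1 := h.gronwall_trunc hN h' ht₀ ht
  rw [hy, hv] at h1
  simp only [sub_self, ne_eq, OfNat.ofNat_ne_zero, not_false_eq_true, zero_pow, add_zero,
    zero_mul] at h1
  have h2 := sq_nonneg (Y t - Z t)
  have h3 := sq_nonneg (V t - W t)
  exact ⟨sub_eq_zero.1 (pow_eq_zero_iff two_ne_zero |>.1 (by linarith)),
    sub_eq_zero.1 (pow_eq_zero_iff two_ne_zero |>.1 (by linarith))⟩

lemma IsSol.eq_of_eq {q Y V Z W : ℝ → ℝ} {I : Set ℝ} [hI : I.OrdConnected] (h : IsSol q I Y V)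
    (h' : IsSol q I Z W) {t₀ t : ℝ} (ht₀ : t₀ ∈ I) (ht : t ∈ I) (hy : Y t₀ = Z t₀)
    (hv : V t₀ = W t₀) : Y t = Z t ∧ V t = W t := by
  have hsub : uIcc t₀ t ⊆ I := hI.uIcc_subset ht₀ ht
  have g := h.mono hsub
  have g' := h'.mono hsub
  obtain ⟨C, hC⟩ := isCompact_uIcc.exists_bound_of_continuousOn g.continuousOn
  obtain ⟨D, hD⟩ := isCompact_uIcc.exists_bound_of_continuousOn g'.continuousOn
  refine IsSol.eq_trunc (N := max C D) g (fun s hs => (hC s hs).trans (le_max_left _ _))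
    (fun s hs => ?_) (left_mem_uIcc) (right_mem_uIcc) hy hv
  have h1 := abs_le.1 ((hD s hs).trans (le_max_right C D))
  rw [trunc_eq_self (lo := fun _ => -max C D) h1.1 h1.2]
  exact g' s hs

/-- Continuation to the right: a solution of `y'' = 6 y ^ 2 + q` with `0 ≤ q` either exists up to
`β` or blows up to `+∞` before. -/
lemma exists_isSol_or_blowup_right {q : ℝ → ℝ} (hq : Continuous q) {α β : ℝ} (hαβ : α < β)
    (hq0 : ∀ t ∈ Icc α β, 0 ≤ q t) (y₀ v₀ : ℝ) :
    (∃ Y V, Y α = y₀ ∧ V α = v₀ ∧ IsSol q (Icc α β) Y V) ∨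
    ∃ b ∈ Ioc α β, ∃ Y V, Y α = y₀ ∧ V α = v₀ ∧ IsSol q (Ico α b) Y V ∧
      Tendsto Y (𝓝[<] b) atTop := by
  have hex : ∀ N : ℕ, ∃ Y V : ℝ → ℝ, Y α = y₀ ∧ V α = v₀ ∧ ∀ t ∈ Ioo (α - 1) (β + 1),
      HasDerivAt Y (V t) t ∧
        HasDerivAt V (6 * trunc (fun _ => -(N : ℝ)) N t (Y t) ^ 2 + q t) t := fun N =>
    exists_trunc_solution hq continuous_const (fun _ => by simp) ⟨by linarith, by linarith⟩ y₀ v₀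
  choose Y V hY0 hV0 hYV using hex
  have hsub : Icc α β ⊆ Ioo (α - 1) (β + 1) := fun t ht => ⟨by linarith [ht.1], by linarith [ht.2]⟩
  set C : ℝ := |y₀| + |v₀| * (β - α) with hC
  have hCnn : 0 ≤ C := by have := sub_pos.2 hαβ; positivity
  have hlow : ∀ N, ∀ t ∈ Icc α β, -C ≤ Y N t := by
    intro N
    have hVm : MonotoneOn (V N) (Icc α β) :=
      monotoneOn_of_hasDerivAt_nonneg (convex_Icc α β) (fun t ht => (hYV N t (hsub ht)).2)
        (fun t ht => by have := hq0 t ht; positivity)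
    have hYm := monotoneOn_of_hasDerivAt_nonneg (convex_Icc α β)
      (f := fun t => Y N t - v₀ * t) (f' := fun t => V N t - v₀)
      (fun t ht => (((hYV N t (hsub ht)).1).sub ((hasDerivAt_id t).const_mul v₀)).congr_deriv
        (by simp))
      (fun t ht => by
        have := hVm (left_mem_Icc.2 hαβ.le) ht ht.1
        rw [hV0] at this; linarith)
    intro t ht
    have h1 := hYm (left_mem_Icc.2 hαβ.le) ht ht.1
    simp only [hY0] at h1
    have h2 : |v₀ * (t - α)| ≤ |v₀| * (β - α) := by
      rw [abs_mul, abs_of_nonneg (sub_nonneg.2 ht.1)]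
      gcongr
      exact ht.2
    have h3 := neg_abs_le y₀
    have h4 := (abs_le.1 h2).1
    nlinarith
  let good : ℕ → ℝ → Prop := fun N s => C ≤ N ∧ ∀ t ∈ Icc α s, Y N t ≤ N
  have hgood_mono : ∀ {N s s'}, good N s → s' ≤ s → good N s' := fun h hs =>
    ⟨h.1, fun t ht => h.2 t ⟨ht.1, ht.2.trans hs⟩⟩
  have hgood_abs : ∀ {N s}, s ≤ β → good N s → ∀ t ∈ Icc α s, |Y N t| ≤ N := fun {N _} hs h t ht =>
    abs_le.2 ⟨by linarith [hlow N t ⟨ht.1, ht.2.trans hs⟩, h.1], h.2 t ht⟩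
  have hgood_sol : ∀ {N s}, s ≤ β → good N s → IsSol q (Icc α s) (Y N) (V N) := by
    intro N s hs h t ht
    have h1 := abs_le.1 (hgood_abs hs h t ht)
    have h2 := hYV N t (hsub ⟨ht.1, ht.2.trans hs⟩)
    rwa [trunc_eq_self (lo := fun _ => -(N : ℝ)) h1.1 h1.2] at h2
  have hgood_eq : ∀ {N N' s}, s ≤ β → good N s → good N' s → ∀ t ∈ Icc α s,
      Y N t = Y N' t ∧ V N t = V N' t := by
    intro N N' s hs h h' t ht
    exact (hgood_sol hs h).eq_of_eq (hgood_sol hs h') (left_mem_Icc.2 (ht.1.trans ht.2)) ht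
      (by simp [hY0]) (by simp [hV0])
  have hext : ∀ (N : ℕ) (s : ℝ), s ∈ Icc α β → C ≤ N → Y N s < N → good N s →
      ∃ s' > s, ∀ x ≤ s', good N x := by
    intro N s hs hCN hlt h
    have hc := (hYV N s (hsub hs)).1.continuousAt
    have := hc.eventually (gt_mem_nhds hlt)
    obtain ⟨η, hη, hball⟩ := Metric.eventually_nhds_iff.1 this
    refine ⟨s + η / 2, by linarith, fun x hx => ⟨hCN, fun t ht => ?_⟩⟩
    rcases le_total t s with hts | hts
    · exact h.2 t ⟨ht.1, hts⟩
    · refine (hball ?_).le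
      rw [Real.dist_eq, abs_of_nonneg (sub_nonneg.2 hts)]
      linarith [ht.2]
  obtain ⟨N₀, hN₀⟩ := exists_nat_gt C
  have hyN : y₀ < N₀ := by
    have := le_abs_self y₀
    have : 0 ≤ |v₀| * (β - α) := mul_nonneg (abs_nonneg _) (by linarith)
    linarith
  obtain ⟨s₀, hs₀, hgs₀⟩ := hext N₀ α (left_mem_Icc.2 hαβ.le) hN₀.le (by rwa [hY0])
    ⟨hN₀.le, fun t ht => by
      rw [le_antisymm ht.2 ht.1, hY0]; exact hyN.le⟩
  by_cases hβ : ∃ N, good N β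
  · obtain ⟨N, hN⟩ := hβ
    exact Or.inl ⟨Y N, V N, hY0 N, hV0 N, hgood_sol le_rfl hN⟩
  right
  set S : Set ℝ := {s | s ∈ Icc α β ∧ ∃ N, good N s} with hS
  have hSb : BddAbove S := ⟨β, fun s hs => hs.1.2⟩
  have hmin : min s₀ β ∈ S :=
    ⟨⟨le_min hs₀.le hαβ.le, min_le_right _ _⟩, N₀, hgs₀ _ (min_le_left _ _)⟩
  set b := sSup S with hb
  have hαb : α < b := (lt_min hs₀ hαβ).trans_le (le_csSup hSb hmin)
  have hbβ : b ≤ β := csSup_le ⟨_, hmin⟩ fun s hs => hs.1.2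
  have hgb : ∀ x < b, ∃ N, good N x := by
    intro x hx
    obtain ⟨s, hs, hxs⟩ := exists_lt_of_lt_csSup ⟨_, hmin⟩ hx
    obtain ⟨N, hN⟩ := hs.2
    exact ⟨N, hgood_mono hN hxs.le⟩
  have hnb : ¬ ∃ N, good N b := by
    rintro ⟨N, hN⟩
    rcases hbβ.eq_or_lt with h | h
    · exact hβ ⟨N, h ▸ hN⟩
    have hsol := hgood_sol hbβ hN
    have heq : ∀ t ∈ Icc α b, Y N t = Y (N + 1) t := fun t ht =>
      (hsol.eq_trunc (N := (N + 1 : ℕ)) (fun t ht => (hgood_abs hbβ hN t ht).trans (by simp))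
        (fun t ht => hYV (N + 1) t (hsub ⟨ht.1, ht.2.trans hbβ⟩)) (left_mem_Icc.2 hαb.le) ht
        (by simp [hY0]) (by simp [hV0])).1
    have hC1 : C ≤ ((N + 1 : ℕ) : ℝ) := by push_cast; linarith [hN.1]
    have hgood1 : good (N + 1) b := ⟨hC1, fun t ht => by
      rw [← heq t ht]; push_cast; linarith [hN.2 t ht]⟩
    obtain ⟨s', hs', hg'⟩ := hext (N + 1) b ⟨hαb.le, hbβ⟩ hC1 (by
      rw [← heq b (right_mem_Icc.2 hαb.le)]; push_cast
      linarith [hN.2 b (right_mem_Icc.2 hαb.le)]) hgood1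
    have : min s' β ∈ S := ⟨⟨le_min (hαb.le.trans hs'.le) hαβ.le, min_le_right _ _⟩, N + 1,
      hg' _ (min_le_left _ _)⟩
    exact absurd (le_csSup hSb this) (not_le.2 (lt_min hs' h))
  choose! n₀ hn₀ using hgb
  classical
  let n : ℝ → ℕ := fun x => if α < x then n₀ x else N₀
  have key : ∀ s < b, ∀ N, good N s → ∀ t ∈ Icc α s, Y (n t) t = Y N t ∧ V (n t) t = V N t := by
    intro s hs N hN t ht
    rcases ht.1.eq_or_lt with h | h
    · rw [← h]; simp [hY0, hV0]
    · have h1 := hn₀ t (ht.2.trans_lt hs)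
      have : n t = n₀ t := by simp [n, h]
      rw [this]
      exact hgood_eq (by linarith [ht.2]) h1 (hgood_mono hN ht.2) t ⟨ht.1, le_rfl⟩
  have hsol : IsSol q (Ico α b) (fun t => Y (n t) t) (fun t => V (n t) t) := by
    intro t ht
    have : ∃ s N, t < s ∧ s < b ∧ good N s ∧
        ∀ᶠ u in 𝓝 t, Y (n u) u = Y N u ∧ V (n u) u = V N u := by
      rcases ht.1.eq_or_lt with h | h
      · have h1 : α < min s₀ b := lt_min hs₀ hαb
        obtain ⟨s, hs1, hs2⟩ := exists_between h1
        have hg : good N₀ s := hgs₀ s (hs2.le.trans (min_le_left _ _))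
        have hsb : s < b := hs2.trans_le (min_le_right _ _)
        refine ⟨s, N₀, h ▸ hs1, hsb, hg, ?_⟩
        filter_upwards [Iio_mem_nhds (h ▸ hs1 : t < s)] with u hu
        rcases le_or_gt u α with hu' | hu'
        · simp [n, not_lt.2 hu']
        · exact key s hsb N₀ hg u ⟨hu'.le, le_of_lt hu⟩
      · obtain ⟨s, hs1, hs2⟩ := exists_between ht.2
        refine ⟨s, n₀ s, hs1, hs2, hn₀ s hs2, ?_⟩
        filter_upwards [Ioo_mem_nhds h hs1] with u hu
        exact key s hs2 _ (hn₀ s hs2) u ⟨hu.1.le, hu.2.le⟩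
    obtain ⟨s, N, hts, hsb, hN, hev⟩ := this
    have h1 := hgood_sol (hsb.le.trans hbβ) hN t ⟨ht.1, hts.le⟩
    have h2 := hev.self_of_nhds
    refine ⟨?_, ?_⟩
    · exact (h1.1.congr_of_eventuallyEq (hev.mono fun u hu => hu.1)).congr_deriv h2.2.symm
    · refine (h1.2.congr_of_eventuallyEq (hev.mono fun u hu => hu.2)).congr_deriv ?_
      simp only [h2.1]
  have hunb : ∀ R, ∃ x ∈ Ico α b, R < Y (n x) x := by
    intro R
    by_contra! hcon
    obtain ⟨N, hN⟩ := exists_nat_ge (max R C)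
    have heq : ∀ t ∈ Ico α b, Y (n t) t = Y N t := by
      intro t ht
      have hs : Icc α t ⊆ Ico α b := fun u hu => ⟨hu.1, hu.2.trans_lt ht.2⟩
      refine ((hsol.mono hs).eq_trunc (N := N) (fun u hu => ?_)
        (fun u hu => hYV N u (hsub ⟨hu.1, (hs hu).2.le.trans hbβ⟩)) (left_mem_Icc.2 ht.1)
        (right_mem_Icc.2 ht.1) (by simp [hY0]) (by simp [hV0])).1
      refine abs_le.2 ⟨?_, (hcon u (hs hu)).trans ((le_max_left _ _).trans hN)⟩
      have := hlow (n u) u ⟨hu.1, (hs hu).2.le.trans hbβ⟩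
      linarith [(le_max_right R C).trans hN]
    refine hnb ⟨N, (le_max_right R C).trans hN, ?_⟩
    have hco : ContinuousOn (Y N) (closure (Ico α b)) := by
      rw [closure_Ico hαb.ne]
      exact fun t ht => (hYV N t (hsub ⟨ht.1, ht.2.trans hbβ⟩)).1.continuousAt.continuousWithinAt
    intro t ht
    rw [← closure_Ico hαb.ne] at ht
    exact le_on_closure (f := Y N) (g := fun _ => (N : ℝ)) (fun u hu => by
      rw [← heq u hu]; exact (hcon u hu).trans ((le_max_left _ _).trans hN)) hco
      continuousOn_const ht
  have hY0' : Y (n α) α = y₀ := hY0 _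
  refine ⟨b, ⟨hαb, hbβ⟩, fun t => Y (n t) t, fun t => V (n t) t, hY0 _, hV0 _, hsol, ?_⟩
  have hqI : ∀ t ∈ Ico α b, 0 ≤ q t := fun t ht => hq0 t ⟨ht.1, ht.2.le.trans hbβ⟩
  have hVm := hsol.monotoneOn_deriv (convex_Ico α b) hqI
  refine tendsto_atTop.2 fun R => ?_
  obtain ⟨x, hx, hRx⟩ := hunb (max R y₀)
  have hαx : α < x := by
    rcases hx.1.eq_or_lt with h | h
    · rw [← h, hY0'] at hRx
      exact absurd hRx (not_lt.2 (le_max_right _ _))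
    · exact h
  obtain ⟨ξ, hξ, hξ'⟩ := exists_hasDerivAt_eq_slope (fun t => Y (n t) t) (fun t => V (n t) t) hαx
    (hsol.mono fun u hu => ⟨hu.1, hu.2.trans_lt hx.2⟩).continuousOn
    (fun u hu => (hsol u ⟨hu.1.le, hu.2.trans hx.2⟩).1)
  have hVξ : 0 < V (n ξ) ξ := by
    rw [hξ', hY0']
    exact div_pos (sub_pos.2 ((le_max_right _ _).trans_lt hRx)) (sub_pos.2 hαx)
  have hYm := monotoneOn_of_hasDerivAt_nonneg (convex_Ico x b)
    (fun u hu => (hsol u ⟨hαx.le.trans hu.1, hu.2⟩).1)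
    (fun u hu => hVξ.le.trans (hVm ⟨hξ.1.le, hξ.2.trans hx.2⟩ ⟨hαx.le.trans hu.1, hu.2⟩
      (hξ.2.le.trans hu.1)))
  filter_upwards [Ioo_mem_nhdsLT hx.2] with u hu
  exact ((le_max_left R y₀).trans hRx.le).trans (hYm (left_mem_Ico.2 hx.2) ⟨hu.1.le, hu.2⟩ hu.1.le)

/-- Continuation to the left. -/
lemma exists_isSol_or_blowup_left {q : ℝ → ℝ} (hq : Continuous q) {α β : ℝ} (hαβ : α < β)
    (hq0 : ∀ t ∈ Icc α β, 0 ≤ q t) (y₀ v₀ : ℝ) :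
    (∃ Y V, Y β = y₀ ∧ V β = v₀ ∧ IsSol q (Icc α β) Y V) ∨
    ∃ b ∈ Ico α β, ∃ Y V, Y β = y₀ ∧ V β = v₀ ∧ IsSol q (Ioc b β) Y V ∧
      Tendsto Y (𝓝[>] b) atTop := by
  rcases exists_isSol_or_blowup_right (q := fun t => q (-t)) (by fun_prop) (neg_lt_neg hαβ)
    (fun t ht => hq0 (-t) ⟨by linarith [ht.2], by linarith [ht.1]⟩) y₀ (-v₀) with
    ⟨Y, V, hY, hV, h⟩ | ⟨b, hb, Y, V, hY, hV, h, ht⟩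
  · refine Or.inl ⟨fun t => Y (-t), fun t => -V (-t), hY, by simp [hV], ?_⟩
    simpa using h.reflect (J := Icc α β)
      (fun t ht => ⟨by linarith [ht.2], by linarith [ht.1]⟩)
  · refine Or.inr ⟨-b, ⟨by linarith [hb.2], by linarith [hb.1]⟩, fun t => Y (-t),
      fun t => -V (-t), hY, by simp [hV], ?_, ?_⟩
    · simpa using h.reflect (J := Ioc (-b) β)
        (fun t ht => ⟨by linarith [ht.2], by linarith [ht.1]⟩)
    · refine ht.comp ?_
      simpa using tendsto_neg_nhdsGT (a := -b)

lemma le_of_tendsto_nhdsLT_of_monotoneOn {f : ℝ → ℝ} {c T L : ℝ} (hf : MonotoneOn f (Ico c T))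
    (hL : Tendsto f (𝓝[<] T) (𝓝 L)) {t : ℝ} (ht : t ∈ Ico c T) : f t ≤ L := by
  refine ge_of_tendsto hL ?_
  filter_upwards [Ioo_mem_nhdsLT ht.2] with u hu
  exact hf ht ⟨ht.1.trans hu.1.le, hu.2⟩ hu.1.le

lemma sub_le_of_neg_le_deriv {f f' : ℝ → ℝ} {c T L A : ℝ} {k : ℕ}
    (hf : ∀ t ∈ Ico c T, HasDerivAt f (f' t) t) (hf' : ∀ t ∈ Ico c T, -(A * (T - t) ^ k) ≤ f' t)
    (hL : Tendsto f (𝓝[<] T) (𝓝 L)) {t : ℝ} (ht : t ∈ Ico c T) :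
    f t - L ≤ A / (k + 1) * (T - t) ^ (k + 1) := by
  have hd : ∀ u, HasDerivAt (fun u => A / (k + 1) * (T - u) ^ (k + 1)) (-(A * (T - u) ^ k)) u := by
    intro u
    have h1 := ((((hasDerivAt_id u).const_sub T).pow (k + 1)).const_mul (A / (k + 1)))
    refine h1.congr_deriv ?_
    have : (k : ℝ) + 1 ≠ 0 := by positivity
    simp
    field_simp
  have hm := monotoneOn_of_hasDerivAt_nonneg (convex_Ico c T)
    (fun u hu => (hf u hu).sub (hd u)) (fun u hu => by linarith [hf' u hu])
  have ht2 : Tendsto (fun u => A / (k + 1) * (T - u) ^ (k + 1)) (𝓝[<] T) (𝓝 0) := by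
    have : ContinuousAt (fun u => A / (k + 1) * (T - u) ^ (k + 1)) T := by fun_prop
    have h := this.tendsto.mono_left (nhdsWithin_le_nhds (s := Iio T))
    simpa using h
  have hlim := hL.sub ht2
  rw [sub_zero] at hlim
  have := le_of_tendsto_nhdsLT_of_monotoneOn hm hlim ht
  simp only [Pi.sub_apply] at this
  linarith

lemma abs_sub_le_of_abs_deriv_le {f f' : ℝ → ℝ} {c T L A : ℝ} {k : ℕ}
    (hf : ∀ t ∈ Ico c T, HasDerivAt f (f' t) t) (hf' : ∀ t ∈ Ico c T, |f' t| ≤ A * (T - t) ^ k)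
    (hL : Tendsto f (𝓝[<] T) (𝓝 L)) {t : ℝ} (ht : t ∈ Ico c T) :
    |f t - L| ≤ A / (k + 1) * (T - t) ^ (k + 1) := by
  have h1 := sub_le_of_neg_le_deriv hf (fun t ht => (abs_le.1 (hf' t ht)).1) hL ht
  have h2 := sub_le_of_neg_le_deriv (f := fun t => -f t) (fun t ht => (hf t ht).neg)
    (fun t ht => neg_le_neg (abs_le.1 (hf' t ht)).2) hL.neg ht
  exact abs_le.2 ⟨by linarith, h1⟩

/-- A solution with a pole at the right end has positive derivative near it. -/
lemma IsSol.eventually_deriv_pos {q Y V : ℝ → ℝ} {c T : ℝ} (hcT : c < T)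
    (h : IsSol q (Ico c T) Y V) (hq : ∀ t ∈ Ico c T, 0 ≤ q t)
    (hY : Tendsto Y (𝓝[<] T) atTop) : ∀ᶠ t in 𝓝[<] T, 0 < V t := by
  have h1 := (hY.eventually_gt_atTop (Y c)).and (Ioo_mem_nhdsLT hcT)
  obtain ⟨x, hx, hcx⟩ := h1.exists
  obtain ⟨ξ, hξ, hξ'⟩ := exists_hasDerivAt_eq_slope Y V hcx.1
    (h.mono fun u hu => ⟨hu.1, hu.2.trans_lt hcx.2⟩).continuousOn
    (fun u hu => (h u ⟨hu.1.le, hu.2.trans hcx.2⟩).1)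
  have hVξ : 0 < V ξ := by
    rw [hξ']
    exact div_pos (sub_pos.2 hx) (sub_pos.2 hcx.1)
  filter_upwards [Ioo_mem_nhdsLT (hξ.2.trans hcx.2)] with u hu
  exact hVξ.trans_le (h.monotoneOn_deriv (convex_Ico c T) hq ⟨hξ.1.le, hξ.2.trans hcx.2⟩
    ⟨hξ.1.le.trans hu.1.le, hu.2⟩ hu.1.le)

/-- Asymptotics at a pole. -/
lemma IsSol.tendsto_sub_inv_sq {q Y V : ℝ → ℝ} {c T K : ℝ} (hcT : c < T)
    (h : IsSol q (Ico c T) Y V) (hq : ∀ t ∈ Ico c T, 0 ≤ q t) (hK : ∀ t ∈ Ico c T, q t ≤ K)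
    (hY : Tendsto Y (𝓝[<] T) atTop) :
    Tendsto (fun t => Y t - 1 / (T - t) ^ 2) (𝓝[<] T) (𝓝 0) := by
  have h1 : ∀ᶠ t in 𝓝[<] T, 1 ≤ Y t ∧ 0 < V t ∧ c ≤ t := by
    filter_upwards [hY.eventually_ge_atTop 1, h.eventually_deriv_pos hcT hq hY, Ioo_mem_nhdsLT hcT]
      with t h1 h2 h3 using ⟨h1, h2, h3.1.le⟩
  obtain ⟨c₁, hc₁, hc₁'⟩ := (mem_nhdsLT_iff_exists_Ico_subset).1 h1
  have hc₁T : c₁ < T := hc₁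
  have hI : ∀ t ∈ Ico c₁ T, t ∈ Ico c T := fun t ht => ⟨(hc₁' ht).2.2, ht.2⟩
  have hKnn : 0 ≤ K := (hq c ⟨le_rfl, hcT⟩).trans (hK c ⟨le_rfl, hcT⟩)
  set G : ℝ → ℝ := fun t => V t ^ 2 - 4 * Y t ^ 3 with hG
  have hGd : ∀ t ∈ Ico c₁ T, HasDerivAt G (2 * V t * q t) t := fun t ht => by
    obtain ⟨d1, d2⟩ := h t (hI t ht)
    refine ((d2.pow 2).sub ((d1.pow 3).const_mul 4)).congr_deriv ?_
    norm_num
    ring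
  have hG1 := monotoneOn_of_hasDerivAt_nonneg (convex_Ico c₁ T) hGd (fun t ht => by
    have := (hc₁' ht).2.1
    have := hq t (hI t ht)
    positivity)
  have hG2 := monotoneOn_of_hasDerivAt_nonneg (convex_Ico c₁ T)
    (fun t ht => ((h t (hI t ht)).1.const_mul (2 * K)).sub (hGd t ht)) (fun t ht => by
    have h1 := (hc₁' ht).2.1
    have h2 := hK t (hI t ht)
    nlinarith)
  have hl := left_mem_Ico.2 hc₁T
  set C₁ : ℝ := |G c₁| + 2 * K with hC₁
  have hC₁0 : 0 ≤ C₁ := by positivity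
  have hGb : ∀ t ∈ Ico c₁ T, |G t| ≤ C₁ * Y t := by
    intro t ht
    have h1 := hG1 hl ht ht.1
    have h2 := hG2 hl ht ht.1
    simp only [Pi.sub_apply] at h2
    have h3 := (hc₁' ht).1
    have h4 := (hc₁' hl).1
    have h5 := neg_abs_le (G c₁)
    have h6 := le_abs_self (G c₁)
    have h7 := abs_nonneg (G c₁)
    rw [hC₁]
    refine abs_le.2 ⟨?_, ?_⟩ <;> nlinarith
  set η : ℝ → ℝ := fun t => (√(Y t))⁻¹ with hη
  have hηpos : ∀ t ∈ Ico c₁ T, 0 < η t := fun t ht => by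
    have := (hc₁' ht).1
    simp only [hη]
    positivity
  have hηY : ∀ t ∈ Ico c₁ T, Y t = 1 / η t ^ 2 := fun t ht => by
    have := (hc₁' ht).1
    simp only [hη]
    rw [inv_pow, Real.sq_sqrt (by linarith)]
    simp
  have hηd : ∀ t ∈ Ico c₁ T, HasDerivAt η (-(V t * η t ^ 3 / 2)) t := fun t ht => by
    have h3 := (hc₁' ht).1
    have hs : 0 < √(Y t) := Real.sqrt_pos.2 (by linarith)
    refine (((h t (hI t ht)).1.sqrt (by linarith)).inv hs.ne').congr_deriv ?_
    simp only [hη]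
    field_simp
  have hηb : ∀ t ∈ Ico c₁ T, |-(V t * η t ^ 3 / 2) + 1| ≤ C₁ / 4 * η t ^ 4 := by
    intro t ht
    have e0 := hηpos t ht
    have e1 := (hc₁' ht).2.1
    set p := V t * η t ^ 3 / 2 with hp
    have hp0 : 0 < p := by positivity
    have e2 : (1 - p) * (1 + p) = -(G t) * η t ^ 6 / 4 := by
      have : G t = V t ^ 2 - 4 * (1 / η t ^ 2) ^ 3 := by rw [← hηY t ht]
      rw [this, hp]
      field_simp
      ring
    have e3 : |1 - p| * (1 + p) ≤ C₁ / 4 * η t ^ 4 := by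
      rw [← abs_of_pos (by linarith : 0 < 1 + p), ← abs_mul, e2, abs_div, abs_mul, abs_neg,
        abs_of_pos (by positivity : 0 < η t ^ 6), abs_of_pos (by norm_num : (0 : ℝ) < 4)]
      have := hGb t ht
      rw [hηY t ht] at this
      calc |G t| * η t ^ 6 / 4 ≤ C₁ * (1 / η t ^ 2) * η t ^ 6 / 4 := by gcongr
        _ = _ := by field_simp
    rw [neg_add_eq_sub]
    nlinarith [abs_nonneg (1 - p)]
  have hη0 : Tendsto η (𝓝[<] T) (𝓝 0) :=
    tendsto_inv_atTop_zero.comp (Real.tendsto_sqrt_atTop.comp hY)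
  have hD : Tendsto (fun t => η t + t) (𝓝[<] T) (𝓝 T) := by
    simpa using hη0.add (tendsto_id.mono_left (nhdsWithin_le_nhds (s := Iio T) (a := T)))
  have h2 : ∀ᶠ t in 𝓝[<] T, C₁ / 4 * η t ^ 4 ≤ 1 / 2 ∧ c₁ ≤ t := by
    have : Tendsto (fun t => C₁ / 4 * η t ^ 4) (𝓝[<] T) (𝓝 0) := by
      simpa using (hη0.pow 4).const_mul (C₁ / 4)
    filter_upwards [this.eventually_le_const (by norm_num : (0 : ℝ) < 1 / 2), Ioo_mem_nhdsLT hc₁T]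
      with t h1 h2 using ⟨h1, h2.1.le⟩
  obtain ⟨c₂, hc₂, hc₂'⟩ := (mem_nhdsLT_iff_exists_Ico_subset).1 h2
  have hc₂T : c₂ < T := hc₂
  have hI2 : ∀ t ∈ Ico c₂ T, t ∈ Ico c₁ T := fun t ht => ⟨(hc₂' ht).2, ht.2⟩
  have hDd : ∀ t ∈ Ico c₂ T, HasDerivAt (fun t => η t + t) (-(V t * η t ^ 3 / 2) + 1) t :=
    fun t ht => (hηd t (hI2 t ht)).add (hasDerivAt_id t)
  have hA : ∀ t ∈ Ico c₂ T, |η t + t - T| ≤ (T - t) / 2 := by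
    intro t ht
    have := abs_sub_le_of_abs_deriv_le (A := 1 / 2) (k := 0) hDd
      (fun u hu => by simpa using (hηb u (hI2 u hu)).trans (hc₂' hu).1) hD ht
    norm_num at this
    linarith
  set C₃ : ℝ := C₁ / 4 * (3 / 2) ^ 4 with hC₃
  have hC₃0 : 0 ≤ C₃ := by positivity
  have hB : ∀ t ∈ Ico c₂ T, |η t + t - T| ≤ C₃ / 5 * (T - t) ^ 5 := by
    intro t ht
    have := abs_sub_le_of_abs_deriv_le (A := C₃) (k := 4) hDd (fun u hu => by
      refine (hηb u (hI2 u hu)).trans ?_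
      have h3 := (abs_le.1 (hA u hu)).2
      have h4 := hηpos u (hI2 u hu)
      calc C₁ / 4 * η u ^ 4 ≤ C₁ / 4 * (3 / 2 * (T - u)) ^ 4 := by gcongr; linarith
        _ = _ := by rw [hC₃]; ring) hD ht
    norm_num at this
    exact this
  have hfin : ∀ t ∈ Ico c₂ T, |Y t - 1 / (T - t) ^ 2| ≤ 2 * C₃ * (T - t) ^ 2 := by
    intro t ht
    have hτ : 0 < T - t := sub_pos.2 ht.2
    have a1 := abs_le.1 (hA t ht)
    have a2 := hB t ht
    have a3 := hηpos t (hI2 t ht)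
    rw [hηY t (hI2 t ht)]
    set τ := T - t with hτd
    have a4 : η t + t - T = η t - τ := by rw [hτd]; ring
    rw [a4] at a1 a2
    have e : 1 / η t ^ 2 - 1 / τ ^ 2 = -((η t - τ) * (τ + η t) / (η t ^ 2 * τ ^ 2)) := by
      field_simp
      ring
    have hlo : τ / 2 ≤ η t := by linarith
    have hhi : η t ≤ 3 / 2 * τ := by linarith
    rw [e, abs_neg, abs_div, abs_mul, abs_of_pos (by positivity : 0 < η t ^ 2 * τ ^ 2),
      abs_of_pos (by positivity : 0 < τ + η t), div_le_iff₀ (by positivity)]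
    calc |η t - τ| * (τ + η t) ≤ C₃ / 5 * τ ^ 5 * (τ + 3 / 2 * τ) := by gcongr
      _ = 2 * C₃ * τ ^ 2 * ((τ / 2) ^ 2 * τ ^ 2) := by ring
      _ ≤ 2 * C₃ * τ ^ 2 * (η t ^ 2 * τ ^ 2) := by gcongr
  have ht : Tendsto (fun t => 2 * C₃ * (T - t) ^ 2) (𝓝[<] T) (𝓝 0) := by
    have : ContinuousAt (fun t => 2 * C₃ * (T - t) ^ 2) T := by fun_prop
    simpa using this.tendsto.mono_left (nhdsWithin_le_nhds (s := Iio T))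
  refine squeeze_zero_norm' ?_ ht
  filter_upwards [Ioo_mem_nhdsLT hc₂T] with t ht
  exact hfin t ⟨ht.1.le, ht.2⟩

lemma nonneg_of_second_order {U U' U'' k : ℝ → ℝ} {a b Λ : ℝ} (hab : a ≤ b)
    (hU : ∀ t ∈ Icc a b, HasDerivAt U (U' t) t ∧ HasDerivAt U' (U'' t) t)
    (hk0 : ∀ t ∈ Icc a b, 0 ≤ k t) (hk : ∀ t ∈ Icc a b, k t ≤ Λ)
    (h : ∀ t ∈ Icc a b, k t * U t ≤ U'' t) (ha : 0 ≤ U a) (ha' : 0 ≤ U' a) :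
    ∀ t ∈ Icc a b, 0 ≤ U t := by
  have hΛ : 0 ≤ Λ := (hk0 a ⟨le_rfl, hab⟩).trans (hk a ⟨le_rfl, hab⟩)
  set E : ℝ → ℝ := fun t => Real.exp ((Λ + 1) * (t - a)) with hE
  have hEpos : ∀ t, 0 < E t := fun t => Real.exp_pos _
  have hEd : ∀ t, HasDerivAt E ((Λ + 1) * E t) t := fun t => by
    have := (((hasDerivAt_id t).sub_const a).const_mul (Λ + 1)).exp
    refine this.congr_deriv ?_
    simp [hE, mul_comm]
  have key : ∀ δ > 0, ∀ t ∈ Icc a b, 0 < U t + δ * E t := by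
    intro δ hδ
    by_contra! hcon
    obtain ⟨t, ht, htU⟩ := hcon
    have hcont : ContinuousOn (fun t => U t + δ * E t) (Icc a b) := fun t ht =>
      ((hU t ht).1.add ((hEd t).const_mul δ)).continuousAt.continuousWithinAt
    have hcl : IsClosed (Icc a b ∩ (fun t => U t + δ * E t) ⁻¹' Iic 0) :=
      hcont.preimage_isClosed_of_isClosed isClosed_Icc isClosed_Iic
    obtain ⟨l, hl⟩ := (isCompact_Icc.of_isClosed_subset hcl inter_subset_left).exists_isLeast
      ⟨t, ht, htU⟩
    obtain ⟨⟨hlab, hl0⟩, hmin⟩ := hl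
    have hl0 : U l + δ * E l ≤ 0 := hl0
    have hpos : ∀ u ∈ Ico a l, 0 < U u + δ * E u := by
      intro u hu
      by_contra! hc
      exact absurd (hmin ⟨⟨hu.1, hu.2.le.trans hlab.2⟩, hc⟩) (not_le.2 hu.2)
    have ha0 : 0 < U a + δ * E a := by have := mul_pos hδ (hEpos a); linarith
    have hal : a < l := by
      rcases hlab.1.eq_or_lt with h | h
      · rw [h] at ha0; linarith
      · exact h
    have hsub : ∀ u ∈ Ico a l, u ∈ Icc a b := fun u hu => ⟨hu.1, hu.2.le.trans hlab.2⟩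
    have hm1 := monotoneOn_of_hasDerivAt_nonneg (convex_Ico a l)
      (f := fun t => U' t + δ * ((Λ + 1) * E t))
      (fun u hu => (hU u (hsub u hu)).2.add (((hEd u).const_mul (Λ + 1)).const_mul δ))
      (fun u hu => by
        have h1 := hpos u hu
        have h2 := h u (hsub u hu)
        have h3 := hk u (hsub u hu)
        have h4 := hk0 u (hsub u hu)
        have h5 : 0 ≤ k u * (U u + δ * E u) := mul_nonneg h4 h1.le
        have h6 : 0 < δ * E u := mul_pos hδ (hEpos u)
        have h7 : 0 ≤ ((Λ + 1) * (Λ + 1) - k u) * (δ * E u) :=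
          mul_nonneg (by nlinarith) h6.le
        nlinarith)
    have hm2 := monotoneOn_of_hasDerivWithinAt_nonneg (convex_Icc a l)
      (f := fun t => U t + δ * E t) (f' := fun t => U' t + δ * ((Λ + 1) * E t))
      (hcont.mono (Icc_subset_Icc_right hlab.2))
      (fun u hu => by
        rw [interior_Icc] at hu
        exact ((hU u (hsub u ⟨hu.1.le, hu.2⟩)).1.add ((hEd u).const_mul δ)).hasDerivWithinAt)
      (fun u hu => by
        rw [interior_Icc] at hu
        refine le_trans ?_ (hm1 (left_mem_Ico.2 hal) ⟨hu.1.le, hu.2⟩ hu.1.le)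
        have := mul_pos hδ (hEpos a)
        simp only
        nlinarith)
    have := hm2 (left_mem_Icc.2 hal.le) (right_mem_Icc.2 hal.le) hal.le
    simp only at this
    linarith
  intro t ht
  by_contra! hneg
  have h1 := key (-U t / E t) (div_pos (neg_pos.2 hneg) (hEpos t)) t ht
  rw [div_mul_cancel₀ _ (hEpos t).ne'] at h1
  linarith

/-- Below a function `z` with `6 z ^ 2 + q ≤ z''` and a pole at `T`, a solution with the same
initial slope is regular at `T`, unless it coincides with `z`. -/
lemma exists_isSol_or_eq_of_pole_right {q z zV zA : ℝ → ℝ} (hq : Continuous q) {t₁ T Y₀ : ℝ}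
    (htT : t₁ < T) (hq0 : ∀ t ∈ Icc t₁ T, 0 ≤ q t)
    (hz : ∀ t ∈ Ico t₁ T, HasDerivAt z (zV t) t ∧ HasDerivAt zV (zA t) t)
    (hzA : ∀ t ∈ Ico t₁ T, 6 * z t ^ 2 + q t ≤ zA t)
    (hzT : Tendsto (fun t => z t - 1 / (T - t) ^ 2) (𝓝[<] T) (𝓝 0))
    (hY₀ : 0 < Y₀) (hYz : Y₀ ≤ z t₁) (hv : 0 < zV t₁) :
    (∃ Y V, Y t₁ = Y₀ ∧ V t₁ = zV t₁ ∧ IsSol q (Icc t₁ T) Y V) ∨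
    (z t₁ = Y₀ ∧ ∀ t ∈ Ioo t₁ T, zA t = 6 * z t ^ 2 + q t) := by
  refine (exists_isSol_or_blowup_right hq htT hq0 Y₀ (zV t₁)).imp_right ?_
  rintro ⟨b, hb, Y, V, hY, hV, hsol, hbl⟩
  have hqb : ∀ t ∈ Ico t₁ b, 0 ≤ q t := fun t ht => hq0 t ⟨ht.1, ht.2.le.trans hb.2⟩
  have hbT : ∀ t ∈ Ico t₁ b, t ∈ Ico t₁ T := fun t ht => ⟨ht.1, ht.2.trans_le hb.2⟩
  have hlb := left_mem_Ico.2 hb.1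
  have hVm := hsol.monotoneOn_deriv (convex_Ico t₁ b) hqb
  have hYm := monotoneOn_of_hasDerivAt_nonneg (convex_Ico t₁ b) (fun t ht => (hsol t ht).1)
    (fun t ht => by have := hVm hlb ht ht.1; rw [hV] at this; exact hv.le.trans this)
  have hzVm := monotoneOn_of_hasDerivAt_nonneg (convex_Ico t₁ b)
    (fun t ht => (hz t (hbT t ht)).2) (fun t ht => by
      have := hzA t (hbT t ht); have := hqb t ht; have := sq_nonneg (z t); linarith)
  have hzm := monotoneOn_of_hasDerivAt_nonneg (convex_Ico t₁ b)
    (fun t ht => (hz t (hbT t ht)).1)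
    (fun t ht => hv.le.trans (hzVm hlb ht ht.1))
  have hYpos : ∀ t ∈ Ico t₁ b, 0 < Y t := fun t ht => by
    have := hYm hlb ht ht.1; rw [hY] at this; linarith
  have hzpos : ∀ t ∈ Ico t₁ b, 0 < z t := fun t ht => by
    have := hzm hlb ht ht.1; linarith
  have hU : ∀ t ∈ Ico t₁ b, HasDerivAt (fun t => z t - Y t) (zV t - V t) t ∧
      HasDerivAt (fun t => zV t - V t) (zA t - (6 * Y t ^ 2 + q t)) t := fun t ht =>
    ⟨(hz t (hbT t ht)).1.sub (hsol t ht).1, (hz t (hbT t ht)).2.sub (hsol t ht).2⟩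
  have hU0 : ∀ t ∈ Ico t₁ b, 0 ≤ z t - Y t := by
    intro s hs
    have hsub : Icc t₁ s ⊆ Ico t₁ b := fun u hu => ⟨hu.1, hu.2.trans_lt hs.2⟩
    refine nonneg_of_second_order (k := fun t => 6 * (z t + Y t)) (Λ := 6 * (z s + Y s)) hs.1
      (fun t ht => hU t (hsub ht)) (fun t ht => ?_) (fun t ht => ?_) (fun t ht => ?_)
      (by rw [hY]; linarith) (by rw [hV]; simp) s ⟨hs.1, le_rfl⟩
    · have := hYpos t (hsub ht); have := hzpos t (hsub ht); positivity
    · have := hYm (hsub ht) hs ht.2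
      have := hzm (hsub ht) hs ht.2
      linarith
    · have := hzA t (hbT t (hsub ht))
      nlinarith
  have hbeq : b = T := by
    by_contra hne
    have hlt : b < T := lt_of_le_of_ne hb.2 hne
    have h1 : Tendsto z (𝓝[<] b) (𝓝 (z b)) :=
      (hz b ⟨hb.1.le, hlt⟩).1.continuousAt.tendsto.mono_left nhdsWithin_le_nhds
    have h2 : Tendsto z (𝓝[<] b) atTop := by
      refine tendsto_atTop_mono' _ ?_ hbl
      filter_upwards [Ioo_mem_nhdsLT hb.1] with t ht
      linarith [hU0 t ⟨ht.1.le, ht.2⟩]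
    exact not_tendsto_nhds_of_tendsto_atTop h2 _ h1
  subst hbeq
  obtain ⟨K, hK⟩ := isCompact_Icc.exists_bound_of_continuousOn (hq.continuousOn (s := Icc t₁ b))
  have hYb := hsol.tendsto_sub_inv_sq (K := K) hb.1 hqb
    (fun t ht => (le_abs_self _).trans (hK t ⟨ht.1, ht.2.le⟩)) hbl
  have hUlim : Tendsto (fun t => z t - Y t) (𝓝[<] b) (𝓝 0) := by
    have := hzT.sub hYb
    rw [sub_zero] at this
    refine this.congr fun t => ?_
    ring
  have hU'm := monotoneOn_of_hasDerivAt_nonneg (convex_Ico t₁ b) (fun t ht => (hU t ht).2)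
    (fun t ht => by
      have h1 := hzA t ht
      have h2 := hU0 t ht
      have h3 := hYpos t ht
      nlinarith)
  have hUm := monotoneOn_of_hasDerivAt_nonneg (convex_Ico t₁ b) (fun t ht => (hU t ht).1)
    (fun t ht => by
      have := hU'm hlb ht ht.1
      simp only [hV, sub_self] at this
      exact this)
  have hUeq : ∀ t ∈ Ico t₁ b, z t - Y t = 0 := fun t ht =>
    le_antisymm (le_of_tendsto_nhdsLT_of_monotoneOn hUm hUlim ht) (hU0 t ht)
  have hzero : ∀ {f f' : ℝ → ℝ}, (∀ t ∈ Ico t₁ b, HasDerivAt f (f' t) t) →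
      (∀ t ∈ Ioo t₁ b, f t = 0) → ∀ t ∈ Ioo t₁ b, f' t = 0 := by
    intro f f' hf hf0 t ht
    have hev : f =ᶠ[𝓝 t] fun _ => 0 := by
      filter_upwards [Ioo_mem_nhds ht.1 ht.2] with u hu using hf0 u hu
    exact (hf t ⟨ht.1.le, ht.2⟩).unique ((hasDerivAt_const t (0 : ℝ)).congr_of_eventuallyEq hev)
  refine ⟨by linarith [hUeq t₁ hlb], fun t ht => ?_⟩
  have h1 := hzero (fun t ht => (hU t ht).2) (hzero (fun t ht => (hU t ht).1)
    fun t ht => hUeq t ⟨ht.1.le, ht.2⟩) t ht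
  rw [sub_eq_zero.1 (hUeq t ⟨ht.1.le, ht.2⟩)]
  linarith

lemma nonpos_of_deriv_le_of_pos {f f' : ℝ → ℝ} {a b : ℝ} (hf : ContinuousOn f (Icc a b))
    (hd : ∀ t ∈ Ioo a b, HasDerivAt f (f' t) t) (ha : f a ≤ 0) (hb : f b ≤ 0)
    (hm : ∀ l r, a < l → l ≤ r → r < b → (∀ t ∈ Icc l r, 0 < f t) → f' l ≤ f' r) :
    ∀ t ∈ Icc a b, f t ≤ 0 := by
  intro x hx
  by_contra! hpos
  have hc1 := hf.mono (Icc_subset_Icc_right hx.2)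
  have hc2 := hf.mono (Icc_subset_Icc_left hx.1)
  obtain ⟨l, ⟨hl, hl0⟩, hlmax⟩ := (isCompact_Icc.of_isClosed_subset
    (hc1.preimage_isClosed_of_isClosed isClosed_Icc isClosed_Iic)
    inter_subset_left).exists_isGreatest (⟨a, ⟨le_rfl, hx.1⟩, ha⟩ : (Icc a x ∩ f ⁻¹' Iic 0).Nonempty)
  obtain ⟨r, ⟨hr, hr0⟩, hrmin⟩ := (isCompact_Icc.of_isClosed_subset
    (hc2.preimage_isClosed_of_isClosed isClosed_Icc isClosed_Iic)
    inter_subset_left).exists_isLeast (⟨b, ⟨hx.2, le_rfl⟩, hb⟩ : (Icc x b ∩ f ⁻¹' Iic 0).Nonempty)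
  have hl0 : f l ≤ 0 := hl0
  have hr0 : f r ≤ 0 := hr0
  have hlx : l < x := lt_of_le_of_ne hl.2 (by rintro rfl; linarith)
  have hxr : x < r := lt_of_le_of_ne hr.1 (by rintro rfl; linarith)
  have hp : ∀ t ∈ Ioo l r, 0 < f t := by
    intro t ht
    by_contra! hcon
    rcases le_total t x with h | h
    · exact absurd (hlmax ⟨⟨hl.1.trans ht.1.le, h⟩, hcon⟩) (not_le.2 ht.1)
    · exact absurd (hrmin ⟨⟨h, ht.2.le.trans hr.2⟩, hcon⟩) (not_le.2 ht.2)
  obtain ⟨ξ, hξ, hξ'⟩ := exists_hasDerivAt_eq_slope f f' hlx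
    (hf.mono (Icc_subset_Icc hl.1 hx.2)) (fun u hu => hd u ⟨hl.1.trans_lt hu.1, hu.2.trans_le hx.2⟩)
  obtain ⟨ζ, hζ, hζ'⟩ := exists_hasDerivAt_eq_slope f f' hxr
    (hf.mono (Icc_subset_Icc hx.1 hr.2)) (fun u hu => hd u ⟨hx.1.trans_lt hu.1, hu.2.trans_le hr.2⟩)
  have h1 : 0 < f' ξ := by rw [hξ']; exact div_pos (by linarith) (by linarith)
  have h2 : f' ζ < 0 := by rw [hζ']; exact div_neg_of_neg_of_pos (by linarith) (by linarith)
  have := hm ξ ζ (hl.1.trans_lt hξ.1) (hξ.2.le.trans hζ.1.le) (hζ.2.trans_le hr.2)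
    (fun t ht => hp t ⟨hξ.1.trans_le ht.1, ht.2.trans_lt hζ.2⟩)
  linarith

/-- `Z` is a `C¹` function with derivative `V` on `[a, b]` and `6 Z ^ 2 + q ≤ V'` in integrated
form. -/
structure SubOn (q : ℝ → ℝ) (a b : ℝ) (Z V : ℝ → ℝ) : Prop where
  hasDeriv : ∀ t ∈ Icc a b, HasDerivWithinAt Z (V t) (Icc a b) t
  integral_le : ∀ l r, a ≤ l → l ≤ r → r ≤ b → ∫ s in l..r, (6 * Z s ^ 2 + q s) ≤ V r - V l

lemma SubOn.continuousOn {q : ℝ → ℝ} {a b : ℝ} {Z V : ℝ → ℝ} (h : SubOn q a b Z V) :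
    ContinuousOn Z (Icc a b) := fun t ht => (h.hasDeriv t ht).continuousWithinAt

lemma subOn_of_hasDerivAt {q : ℝ → ℝ} (hq : Continuous q) {a b : ℝ} {Z V A : ℝ → ℝ}
    (h : ∀ t ∈ Icc a b, HasDerivAt Z (V t) t ∧ HasDerivAt V (A t) t)
    (hA : ∀ t ∈ Icc a b, 6 * Z t ^ 2 + q t ≤ A t) : SubOn q a b Z V := by
  refine ⟨fun t ht => (h t ht).1.hasDerivWithinAt, fun l r hl hlr hr => ?_⟩
  have hsub : Icc l r ⊆ Icc a b := Icc_subset_Icc hl hr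
  refine intervalIntegral.integral_le_sub_of_hasDeriv_right_of_le hlr
    (fun t ht => (h t (hsub ht)).2.continuousAt.continuousWithinAt)
    (fun t ht => (h t (hsub (Ioo_subset_Icc_self ht))).2.hasDerivWithinAt) ?_
    (fun t ht => hA t (hsub (Ioo_subset_Icc_self ht)))
  refine ContinuousOn.integrableOn_Icc ?_
  have : ContinuousOn Z (Icc l r) :=
    fun t ht => (h t (hsub ht)).1.continuousAt.continuousWithinAt
  fun_prop

lemma IsSol.subOn {q : ℝ → ℝ} (hq : Continuous q) {a b : ℝ} {Z V : ℝ → ℝ}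
    (h : IsSol q (Icc a b) Z V) : SubOn q a b Z V :=
  subOn_of_hasDerivAt hq h fun _ _ => le_rfl

lemma SubOn.congr {q : ℝ → ℝ} {a b : ℝ} {Z V Z' V' : ℝ → ℝ} (h : SubOn q a b Z V)
    (hZ : EqOn Z' Z (Icc a b)) (hV : EqOn V' V (Icc a b)) : SubOn q a b Z' V' := by
  refine ⟨fun t ht => ?_, fun l r hl hlr hr => ?_⟩
  · rw [hV ht]
    exact (h.hasDeriv t ht).congr hZ (hZ ht)
  · rw [hV ⟨hl, hlr.trans hr⟩, hV ⟨hl.trans hlr, hr⟩]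
    refine le_of_eq_of_le (intervalIntegral.integral_congr fun t ht => ?_)
      (h.integral_le l r hl hlr hr)
    rw [uIcc_of_le hlr] at ht
    simp only [hZ ⟨hl.trans ht.1, ht.2.trans hr⟩]

lemma SubOn.union {q : ℝ → ℝ} (hq : Continuous q) {a b c : ℝ} {Z V : ℝ → ℝ} (hac : a ≤ c)
    (hcb : c ≤ b) (h : SubOn q a c Z V) (h' : SubOn q c b Z V) : SubOn q a b Z V := by
  have hu : Icc a b = Icc a c ∪ Icc c b := (Icc_union_Icc_eq_Icc hac hcb).symm
  refine ⟨fun t ht => ?_, fun l r hl hlr hr => ?_⟩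
  · rcases lt_trichotomy t c with htc | htc | htc
    · exact (h.hasDeriv t ⟨ht.1, htc.le⟩).mono_of_mem_nhdsWithin
        (mem_nhdsWithin.2 ⟨Iio c, isOpen_Iio, htc, fun u hu => ⟨hu.2.1, (mem_Iio.1 hu.1).le⟩⟩)
    · subst htc
      rw [hu]
      exact (h.hasDeriv t ⟨hac, le_rfl⟩).union (h'.hasDeriv t ⟨le_rfl, hcb⟩)
    · exact (h'.hasDeriv t ⟨htc.le, ht.2⟩).mono_of_mem_nhdsWithin
        (mem_nhdsWithin.2 ⟨Ioi c, isOpen_Ioi, htc, fun u hu => ⟨(mem_Ioi.1 hu.1).le, hu.2.2⟩⟩)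
  · rcases le_total r c with hrc | hrc
    · exact h.integral_le l r hl hlr hrc
    rcases le_total c l with hcl | hcl
    · exact h'.integral_le l r hcl hlr hr
    have i1 : IntervalIntegrable (fun s => 6 * Z s ^ 2 + q s) MeasureTheory.volume l c := by
      refine ContinuousOn.intervalIntegrable ?_
      rw [uIcc_of_le hcl]
      have := h.continuousOn.mono (Icc_subset_Icc_left hl)
      fun_prop
    have i2 : IntervalIntegrable (fun s => 6 * Z s ^ 2 + q s) MeasureTheory.volume c r := by
      refine ContinuousOn.intervalIntegrable ?_
      rw [uIcc_of_le hrc]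
      have := h'.continuousOn.mono (Icc_subset_Icc_right hr)
      fun_prop
    rw [← intervalIntegral.integral_add_adjacent_intervals i1 i2]
    linarith [h.integral_le l c hl hcl le_rfl, h'.integral_le c r le_rfl hrc hr]

lemma SubOn.glue {q : ℝ → ℝ} (hq : Continuous q) {a b c : ℝ} {Z₁ V₁ Z₂ V₂ : ℝ → ℝ}
    (hac : a ≤ c) (hcb : c ≤ b) (h : SubOn q a c Z₁ V₁) (h' : SubOn q c b Z₂ V₂)
    (hZ : Z₁ c = Z₂ c) (hV : V₁ c = V₂ c) :
    SubOn q a b (fun t => if t ≤ c then Z₁ t else Z₂ t) (fun t => if t ≤ c then V₁ t else V₂ t) := by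
  have aux : ∀ {F G : ℝ → ℝ}, F c = G c →
      EqOn (fun t => if t ≤ c then F t else G t) G (Icc c b) := by
    intro F G hFG t ht
    rcases ht.1.eq_or_lt with h | h
    · simp [← h, hFG]
    · simp [not_le.2 h]
  exact SubOn.union hq hac hcb (h.congr (fun t ht => by simp [ht.2]) (fun t ht => by simp [ht.2]))
    (h'.congr (aux hZ) (aux hV))

/-- A subsolution on a compact interval yields a solution on the same interval. -/
lemma SubOn.exists_isSol {q : ℝ → ℝ} (hq : Continuous q) {a b : ℝ} {Z V : ℝ → ℝ} (hab : a < b)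
    (hq0 : ∀ t ∈ Icc a b, 0 ≤ q t) (h : SubOn q a b Z V) :
    ∃ Y W, IsSol q (Icc a b) Y W := by
  obtain ⟨M, hM⟩ := isCompact_Icc.exists_bound_of_continuousOn h.continuousOn
  obtain ⟨Q, hQ⟩ := isCompact_Icc.exists_bound_of_continuousOn (hq.continuousOn (s := Icc a b))
  set lo : ℝ → ℝ := fun t => Z (projIcc a b hab.le t) with hlo
  have hloc : Continuous lo := by
    have := (continuousOn_iff_continuous_domRestrict.1 h.continuousOn).comp
      (continuous_projIcc (h := hab.le))
    exact this
  have hloZ : ∀ t ∈ Icc a b, lo t = Z t := fun t ht => by simp [hlo, projIcc_of_mem hab.le ht]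
  have hloM : ∀ t, |lo t| ≤ M := fun t => hM _ (projIcc a b hab.le t).2
  have hM0 : 0 ≤ M := (abs_nonneg _).trans (hloM a)
  have hL := left_mem_Icc.2 hab.le
  have hR := right_mem_Icc.2 hab.le
  have hsub : ∀ t ∈ Icc a b, t ∈ Ioo (a - 1) (b + 1) :=
    fun t ht => ⟨by linarith [ht.1], by linarith [ht.2]⟩
  have hex := fun σ : ℝ => exists_trunc_solution hq hloc hloM (t₀ := a) (a := a - 1) (b := b + 1)
    (hsub a hL) (Z a) σ
  choose Y W hYa hWa hYW using hex
  have hYW' : ∀ σ, ∀ t ∈ Icc a b, HasDerivAt (Y σ) (W σ t) t ∧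
    HasDerivAt (W σ) (6 * trunc lo M t (Y σ t) ^ 2 + q t) t := fun σ t ht => hYW σ t (hsub t ht)
  have hWm : ∀ σ, MonotoneOn (W σ) (Icc a b) := fun σ =>
    monotoneOn_of_hasDerivAt_nonneg (convex_Icc a b) (fun t ht => (hYW' σ t ht).2)
      (fun t ht => by have := hq0 t ht; positivity)
  have hcont : Continuous fun σ => Y σ b := by
    refine LipschitzWith.continuous (K := ⟨Real.exp ((1 + 12 * M) * |b - a| / 2), by positivity⟩)
      (LipschitzWith.of_dist_le_mul fun σ τ => ?_)
    have h1 := gronwall_second_order (K := 12 * M) (by positivity) (hYW' σ) (hYW' τ)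
      (fun t _ => abs_trunc_sq_sub_le hloM t _ _ _) hL hR
    rw [hYa, hYa, hWa, hWa, sub_self] at h1
    rw [Real.dist_eq, Real.dist_eq]
    refine abs_le_of_sq_le_sq ?_ (mul_nonneg (NNReal.coe_nonneg _) (abs_nonneg _))
    change _ ≤ (Real.exp ((1 + 12 * M) * |b - a| / 2) * |σ - τ|) ^ 2
    rw [mul_pow, sq_abs, sq (Real.exp _), ← Real.exp_add, add_halves]
    nlinarith [sq_nonneg (W σ b - W τ b)]
  have hlow : ∀ σ, Z a + σ * (b - a) ≤ Y σ b := by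
    intro σ
    have := monotoneOn_of_hasDerivAt_nonneg (convex_Icc a b)
      (f := fun t => Y σ t - σ * t) (f' := fun t => W σ t - σ)
      (fun t ht => ((hYW' σ t ht).1.sub ((hasDerivAt_id t).const_mul σ)).congr_deriv (by simp))
      (fun t ht => by have := hWm σ hL ht ht.1; rw [hWa] at this; linarith) hL hR hab.le
    simp only [hYa] at this
    linarith
  set B := 6 * M ^ 2 + Q with hB
  have hhigh : ∀ σ, Y σ b ≤ Z a + (σ + B * (b - a)) * (b - a) := by
    intro σ
    have hW := monotoneOn_of_hasDerivAt_nonneg (convex_Icc a b)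
      (f := fun t => B * t - W σ t) (f' := fun t => B - (6 * trunc lo M t (Y σ t) ^ 2 + q t))
      (fun t ht => (((hasDerivAt_id t).const_mul B).sub (hYW' σ t ht).2).congr_deriv (by simp))
      (fun t ht => by
        have h1 := abs_trunc_le hloM t (Y σ t)
        have h2 := (le_abs_self _).trans (hQ t ht)
        have h3 := sq_le_sq' (by linarith [(abs_le.1 h1).1]) (abs_le.1 h1).2
        simp only [hB]
        linarith)
    have hB0 : 0 ≤ B := by
      have := (abs_nonneg _).trans (hQ a hL)
      positivity
    have := monotoneOn_of_hasDerivAt_nonneg (convex_Icc a b)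
      (f := fun t => (σ + B * (b - a)) * t - Y σ t) (f' := fun t => σ + B * (b - a) - W σ t)
      (fun t ht => (((hasDerivAt_id t).const_mul _).sub (hYW' σ t ht).1).congr_deriv (by simp))
      (fun t ht => by
        have := hW hL ht ht.1
        simp only [hWa] at this
        have := mul_le_mul_of_nonneg_left ht.2 hB0
        linarith) hL hR hab.le
    simp only [hYa] at this
    linarith
  have hba : 0 < b - a := sub_pos.2 hab
  obtain ⟨σ, hσ⟩ : Z b ∈ range fun σ => Y σ b := by
    refine mem_range_of_exists_le_of_exists_ge hcont
      ⟨(Z b - Z a) / (b - a) - B * (b - a), (hhigh _).trans (le_of_eq ?_)⟩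
      ⟨(Z b - Z a) / (b - a), le_trans (le_of_eq ?_) (hlow _)⟩
    · field_simp
      ring
    · field_simp
      ring
  have hσ : Y σ b = Z b := hσ
  have hYcont : ContinuousOn (Y σ) (Icc a b) := fun t ht =>
    (hYW' σ t ht).1.continuousAt.continuousWithinAt
  have hZY : ∀ t ∈ Icc a b, Z t - Y σ t ≤ 0 := by
    refine nonpos_of_deriv_le_of_pos (f' := fun t => V t - W σ t) (h.continuousOn.sub hYcont)
      (fun t ht => ((h.hasDeriv t ⟨ht.1.le, ht.2.le⟩).hasDerivAt (Icc_mem_nhds ht.1 ht.2)).sub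
        (hYW' σ t ⟨ht.1.le, ht.2.le⟩).1) (by simp [hYa]) (by simp [hσ]) ?_
    intro l r hl hlr hr hpos
    have h1 := h.integral_le l r hl.le hlr hr.le
    have hsub' : ∀ t ∈ uIcc l r, t ∈ Icc a b := by
      rw [uIcc_of_le hlr]
      exact fun t ht => ⟨hl.le.trans ht.1, ht.2.trans hr.le⟩
    have h2 : ∫ s in l..r, (6 * Z s ^ 2 + q s) = W σ r - W σ l := by
      refine intervalIntegral.integral_eq_sub_of_hasDerivAt (fun t ht => ?_) ?_
      · have hp := hpos t (by rwa [uIcc_of_le hlr] at ht)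
        refine (hYW' σ t (hsub' t ht)).2.congr_deriv ?_
        have h3 : Y σ t ≤ M := by
          have := (le_abs_self _).trans (hM t (hsub' t ht))
          linarith
        rw [trunc, hloZ t (hsub' t ht), min_eq_left h3, max_eq_left (by linarith)]
      · refine ContinuousOn.intervalIntegrable ?_
        have := h.continuousOn.mono hsub'
        fun_prop
    linarith
  have hYM : ∀ t ∈ Icc a b, Y σ t - M ≤ 0 := by
    refine nonpos_of_deriv_le_of_pos (f' := W σ) (hYcont.sub continuousOn_const)
      (fun t ht => (hYW' σ t ⟨ht.1.le, ht.2.le⟩).1.sub_const M) ?_ ?_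
      (fun l r hl hlr hr _ => hWm σ ⟨hl.le, hlr.trans hr.le⟩ ⟨hl.le.trans hlr, hr.le⟩ hlr)
    · rw [hYa]; linarith [(le_abs_self _).trans (hM a hL)]
    · rw [hσ]; linarith [(le_abs_self _).trans (hM b hR)]
  refine ⟨Y σ, W σ, fun t ht => ?_⟩
  have h1 := hYW' σ t ht
  rwa [trunc_eq_self (by rw [hloZ t ht]; linarith [hZY t ht]) (by linarith [hYM t ht])] at h1

/-- A solution with a pole at the right end only can be perturbed to one regular at both ends. -/
lemma IsSol.exists_isSol_of_pole_right {q y V : ℝ → ℝ} (hq : Continuous q) {a T : ℝ} (haT : a < T)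
    (hq0 : ∀ t ∈ Icc a T, 0 ≤ q t) (h : IsSol q (Ico a T) y V) (hy : Tendsto y (𝓝[<] T) atTop) :
    ∃ Y W, IsSol q (Icc a T) Y W := by
  have hq0' : ∀ t ∈ Ico a T, 0 ≤ q t := fun t ht => hq0 t ⟨ht.1, ht.2.le⟩
  obtain ⟨K, hK⟩ := isCompact_Icc.exists_bound_of_continuousOn (hq.continuousOn (s := Icc a T))
  have hasym := h.tendsto_sub_inv_sq (K := K) haT hq0'
    (fun t ht => (le_abs_self _).trans (hK t ⟨ht.1, ht.2.le⟩)) hy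
  obtain ⟨t₁, ⟨hy1, hV1⟩, ht₁⟩ := (((hy.eventually_gt_atTop 1).and
    (h.eventually_deriv_pos haT hq0' hy)).and (Ioo_mem_nhdsLT haT)).exists
  have hsub : Icc a t₁ ⊆ Ico a T := fun t ht => ⟨ht.1, ht.2.trans_lt ht₁.2⟩
  obtain ⟨C, hC⟩ := isCompact_Icc.exists_bound_of_continuousOn (h.mono hsub).continuousOn
  have hC0 : 0 ≤ C := (norm_nonneg _).trans (hC t₁ (right_mem_Icc.2 ht₁.1.le))
  set κ := 12 * C + 1 with hκ
  set H := Real.cosh (κ * (a - t₁)) with hH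
  have hH1 : 1 ≤ H := Real.one_le_cosh _
  set ε := 1 / (12 * H) with hε
  have hε0 : 0 < ε := by positivity
  have hεH : ε * H = 1 / 12 := by rw [hε]; field_simp
  have hε1 : ε < 1 := by nlinarith
  rcases exists_isSol_or_eq_of_pole_right hq ht₁.2
    (fun t ht => hq0 t ⟨ht₁.1.le.trans ht.1, ht.2⟩)
    (fun t ht => h t ⟨ht₁.1.le.trans ht.1, ht.2⟩) (fun t ht => le_rfl) hasym
    (Y₀ := y t₁ - ε) (by linarith) (by linarith) hV1 with ⟨Y, W, hY, hW, hsol⟩ | ⟨h1, -⟩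
  swap
  · linarith
  have hd : ∀ t ∈ Icc a t₁,
      HasDerivAt (fun t => y t - ε * (2 - Real.cosh (κ * (t - t₁))))
        (V t + ε * (κ * Real.sinh (κ * (t - t₁)))) t ∧
      HasDerivAt (fun t => V t + ε * (κ * Real.sinh (κ * (t - t₁))))
        (6 * y t ^ 2 + q t + ε * (κ ^ 2 * Real.cosh (κ * (t - t₁)))) t := by
    intro t ht
    obtain ⟨d1, d2⟩ := h t (hsub ht)
    have e := ((hasDerivAt_id t).sub_const t₁).const_mul κ
    refine ⟨(d1.sub ((e.cosh.const_sub 2).const_mul ε)).congr_deriv ?_,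
      (d2.add ((e.sinh.const_mul κ).const_mul ε)).congr_deriv ?_⟩
    · simp only [id]
      ring
    · simp only [id]
      ring
  have hZ := subOn_of_hasDerivAt hq hd fun t ht => by
    have c1 : 1 ≤ Real.cosh (κ * (t - t₁)) := Real.one_le_cosh _
    have c2 : Real.cosh (κ * (t - t₁)) ≤ H := by
      rw [hH, Real.cosh_le_cosh, abs_mul, abs_mul, abs_of_nonpos (sub_nonpos.2 ht.2),
        abs_of_nonpos (sub_nonpos.2 ht₁.1.le)]
      have := ht.1
      gcongr
    obtain ⟨y1, y2⟩ := abs_le.1 (hC t ht)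
    set c := Real.cosh (κ * (t - t₁))
    have e1 : ε * c ≤ 1 / 12 := by rw [← hεH]; gcongr
    have e2 : -(C * c) ≤ y t * (2 - c) := by
      rcases le_total 2 c with h | h <;> nlinarith
    have e3 : (2 - c) ^ 2 ≤ c ^ 2 := by nlinarith
    have e5 : ε * (2 - c) ^ 2 ≤ c / 12 := by
      calc ε * (2 - c) ^ 2 ≤ ε * c ^ 2 := by gcongr
        _ = ε * c * c := by ring
        _ ≤ 1 / 12 * c := by gcongr
        _ = c / 12 := by ring
    have e6 : (12 * C + 1) * c ≤ κ ^ 2 * c := by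
      have : 12 * C + 1 ≤ κ ^ 2 := by rw [hκ]; nlinarith
      gcongr
    have e7 : 0 ≤ ε * (κ ^ 2 * c + 12 * (y t * (2 - c)) - 6 * (ε * (2 - c) ^ 2)) :=
      mul_nonneg hε0.le (by linarith)
    linarith
  refine (hZ.glue hq ht₁.1.le ht₁.2.le (hsol.subOn hq) ?_ ?_).exists_isSol hq haT hq0
  · simp [hY]; ring
  · simp [hW]

lemma IsSol.exists_isSol_of_pole_left {q y V : ℝ → ℝ} (hq : Continuous q) {a T : ℝ} (haT : a < T)
    (hq0 : ∀ t ∈ Icc a T, 0 ≤ q t) (h : IsSol q (Ioc a T) y V) (hy : Tendsto y (𝓝[>] a) atTop) :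
    ∃ Y W, IsSol q (Icc a T) Y W := by
  obtain ⟨Y, W, hYW⟩ := (h.reflect (J := Ico (-T) (-a))
    (fun t ht => ⟨by linarith [ht.2], by linarith [ht.1]⟩)).exists_isSol_of_pole_right
    (by fun_prop) (neg_lt_neg haT)
    (fun t ht => hq0 (-t) ⟨by linarith [ht.2], by linarith [ht.1]⟩)
    (hy.comp (by simpa using tendsto_neg_nhdsLT (a := -a)))
  refine ⟨fun t => Y (-t), fun t => -W (-t), ?_⟩
  simpa using hYW.reflect (J := Icc a T) (fun t ht => ⟨by linarith [ht.2], by linarith [ht.1]⟩)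

/-- Near a common pole, the mean of two different solutions has the same data as a solution
regular at the pole. -/
lemma IsSol.eventually_exists_isSol_mean_right {q y₁ V₁ y₂ V₂ : ℝ → ℝ} (hq : Continuous q)
    {a T x : ℝ} (hq0 : ∀ t ∈ Icc a T, 0 ≤ q t)
    (h₁ : IsSol q (Ioo a T) y₁ V₁) (h₂ : IsSol q (Ioo a T) y₂ V₂)
    (hy₁ : Tendsto y₁ (𝓝[<] T) atTop) (hy₂ : Tendsto y₂ (𝓝[<] T) atTop)
    (hx : x ∈ Ioo a T) (hne : y₁ x ≠ y₂ x) :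
    ∀ᶠ t in 𝓝[<] T, ∃ Y W, Y t = (y₁ t + y₂ t) / 2 ∧ W t = (V₁ t + V₂ t) / 2 ∧
      IsSol q (Icc t T) Y W := by
  have hsub : Ico x T ⊆ Ioo a T := fun t ht => ⟨hx.1.trans_le ht.1, ht.2⟩
  have hq0' : ∀ t ∈ Ico x T, 0 ≤ q t := fun t ht => hq0 t ⟨(hsub ht).1.le, ht.2.le⟩
  obtain ⟨K, hK⟩ := isCompact_Icc.exists_bound_of_continuousOn (hq.continuousOn (s := Icc x T))
  have hK' : ∀ t ∈ Ico x T, q t ≤ K := fun t ht => (le_abs_self _).trans (hK t ⟨ht.1, ht.2.le⟩)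
  have asym := ((h₁.mono hsub).tendsto_sub_inv_sq hx.2 hq0' hK' hy₁).add
    ((h₂.mono hsub).tendsto_sub_inv_sq hx.2 hq0' hK' hy₂) |>.div_const 2
  rw [add_zero, zero_div] at asym
  filter_upwards [hy₁.eventually_gt_atTop 0, hy₂.eventually_gt_atTop 0,
    (h₁.mono hsub).eventually_deriv_pos hx.2 hq0' hy₁,
    (h₂.mono hsub).eventually_deriv_pos hx.2 hq0' hy₂, Ioo_mem_nhdsLT hx.2] with t p1 p2 p3 p4 ht
  have hsub' : Ico t T ⊆ Ioo a T := fun u hu => hsub ⟨ht.1.le.trans hu.1, hu.2⟩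
  rcases exists_isSol_or_eq_of_pole_right hq ht.2 (z := fun t => (y₁ t + y₂ t) / 2)
    (zV := fun t => (V₁ t + V₂ t) / 2)
    (zA := fun t => ((6 * y₁ t ^ 2 + q t) + (6 * y₂ t ^ 2 + q t)) / 2)
    (fun u hu => hq0 u ⟨(hx.1.trans ht.1).le.trans hu.1, hu.2⟩)
    (fun u hu => ⟨((h₁ u (hsub' hu)).1.add (h₂ u (hsub' hu)).1).div_const 2,
      ((h₁ u (hsub' hu)).2.add (h₂ u (hsub' hu)).2).div_const 2⟩)
    (fun u _ => by nlinarith [sq_nonneg (y₁ u - y₂ u)])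
    (asym.congr fun u => by ring) (Y₀ := (y₁ t + y₂ t) / 2) (by positivity) le_rfl
    (by positivity) with h | ⟨-, h⟩
  · exact h
  · exfalso
    obtain ⟨s, hs⟩ := exists_between ht.2
    have heq : ∀ u ∈ Ioo t T, y₁ u = y₂ u := fun u hu => by
      have := h u hu
      have h0 : (y₁ u - y₂ u) ^ 2 = 0 := by linarith
      exact sub_eq_zero.1 (pow_eq_zero_iff two_ne_zero |>.1 h0)
    have hs' : s ∈ Ioo a T := hsub' ⟨hs.1.le, hs.2⟩
    have hV : V₁ s = V₂ s := by
      refine (h₁ s hs').1.unique ((h₂ s hs').1.congr_of_eventuallyEq ?_)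
      filter_upwards [Ioo_mem_nhds hs.1 hs.2] with u hu using heq u hu
    exact hne (h₁.eq_of_eq h₂ hs' hx (heq s hs) hV).1

lemma IsSol.eventually_exists_isSol_mean_left {q y₁ V₁ y₂ V₂ : ℝ → ℝ} (hq : Continuous q)
    {a T x : ℝ} (hq0 : ∀ t ∈ Icc a T, 0 ≤ q t)
    (h₁ : IsSol q (Ioo a T) y₁ V₁) (h₂ : IsSol q (Ioo a T) y₂ V₂)
    (hy₁ : Tendsto y₁ (𝓝[>] a) atTop) (hy₂ : Tendsto y₂ (𝓝[>] a) atTop)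
    (hx : x ∈ Ioo a T) (hne : y₁ x ≠ y₂ x) :
    ∀ᶠ t in 𝓝[>] a, ∃ Y W, Y t = (y₁ t + y₂ t) / 2 ∧ W t = (V₁ t + V₂ t) / 2 ∧
      IsSol q (Icc a t) Y W := by
  have hI : ∀ t ∈ Ioo (-T) (-a), -t ∈ Ioo a T :=
    fun t ht => ⟨by linarith [ht.2], by linarith [ht.1]⟩
  have hlim : Tendsto (fun t : ℝ => -t) (𝓝[<] (-a)) (𝓝[>] a) := by
    simpa using tendsto_neg_nhdsLT (a := -a)
  have key := (h₁.reflect hI).eventually_exists_isSol_mean_right (x := -x) (by fun_prop)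
    (fun t ht => hq0 (-t) ⟨by linarith [ht.2], by linarith [ht.1]⟩) (h₂.reflect hI)
    (hy₁.comp hlim) (hy₂.comp hlim) ⟨by linarith [hx.2], by linarith [hx.1]⟩ (by simpa using hne)
  filter_upwards [(tendsto_neg_nhdsGT (a := a)).eventually key] with t ⟨Y, W, hY, hW, h⟩
  refine ⟨fun t => Y (-t), fun t => -W (-t), by simpa using hY, ?_, ?_⟩
  · simp only [hW, neg_neg]
    ring
  · simpa using h.reflect (J := Icc a t) (fun t ht => ⟨by linarith [ht.2], by linarith [ht.1]⟩)

/-- Two different solutions with poles at the same two ends force a solution regular at both. -/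
lemma IsSol.exists_isSol_of_two_poles {q y₁ V₁ y₂ V₂ : ℝ → ℝ} (hq : Continuous q)
    {a T x : ℝ} (hq0 : ∀ t ∈ Icc a T, 0 ≤ q t)
    (h₁ : IsSol q (Ioo a T) y₁ V₁) (h₂ : IsSol q (Ioo a T) y₂ V₂)
    (ha₁ : Tendsto y₁ (𝓝[>] a) atTop) (ha₂ : Tendsto y₂ (𝓝[>] a) atTop)
    (hT₁ : Tendsto y₁ (𝓝[<] T) atTop) (hT₂ : Tendsto y₂ (𝓝[<] T) atTop)
    (hx : x ∈ Ioo a T) (hne : y₁ x ≠ y₂ x) :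
    ∃ Y W, IsSol q (Icc a T) Y W := by
  obtain ⟨t₀, ⟨Y₀, W₀, hY₀, hW₀, hs₀⟩, ht₀⟩ := ((h₁.eventually_exists_isSol_mean_left hq hq0 h₂
    ha₁ ha₂ hx hne).and (Ioo_mem_nhdsGT hx.1)).exists
  obtain ⟨t₁, ⟨Y₁, W₁, hY₁, hW₁, hs₁⟩, ht₁⟩ := ((h₁.eventually_exists_isSol_mean_right hq hq0 h₂
    hT₁ hT₂ hx hne).and (Ioo_mem_nhdsLT hx.2)).exists
  have h01 : t₀ < t₁ := ht₀.2.trans ht₁.1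
  have hsub : Icc t₀ t₁ ⊆ Ioo a T := fun u hu => ⟨ht₀.1.trans_le hu.1, hu.2.trans_lt ht₁.2⟩
  have hm : SubOn q t₀ t₁ (fun t => (y₁ t + y₂ t) / 2) (fun t => (V₁ t + V₂ t) / 2) :=
    subOn_of_hasDerivAt hq
      (fun u hu => ⟨((h₁ u (hsub hu)).1.add (h₂ u (hsub hu)).1).div_const 2,
        ((h₁ u (hsub hu)).2.add (h₂ u (hsub hu)).2).div_const 2⟩)
      (fun u _ => by nlinarith [sq_nonneg (y₁ u - y₂ u)])
  have hg := (hs₀.subOn hq).glue hq ht₀.1.le h01.le hm hY₀ hW₀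
  refine (hg.glue hq (ht₀.1.trans h01).le ht₁.2.le (hs₁.subOn hq) ?_ ?_).exists_isSol hq
    (hx.1.trans hx.2) hq0
  · simp [not_le.2 h01, hY₁]
  · simp [not_le.2 h01, hW₁]

/-- No solution of `y'' = 6 y ^ 2 - x` exists on an interval of length `6` of the negative axis. -/
lemma not_isSol_Icc_sub_six {x₀ : ℝ} (hx₀ : x₀ ≤ 0) {Y V : ℝ → ℝ} :
    ¬ IsSol (fun x => -x) (Icc (x₀ - 6) x₀) Y V := by
  intro h
  set P : ℝ → ℝ := fun u => 7776 / 5 * u ^ 5 - 1080 * u ^ 6 + 2160 / 7 * u ^ 7 - 45 * u ^ 8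
    + 10 / 3 * u ^ 9 - 1 / 10 * u ^ 10
    - (7776 * u - 6048 * u ^ 2 + 2240 * u ^ 3 - 392 * u ^ 4 + 392 / 15 * u ^ 5) with hP
  have hPd : ∀ u, HasDerivAt P (u ^ 4 * (6 - u) ^ 5 - (432 - 56 * (u * (6 - u))) ^ 2 / 24) u := by
    intro u
    have d := fun n : ℕ => hasDerivAt_pow n u
    refine ((((((((d 5).const_mul (7776 / 5)).sub ((d 6).const_mul 1080)).add
      ((d 7).const_mul (2160 / 7))).sub ((d 8).const_mul 45)).add ((d 9).const_mul (10 / 3))).sub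
      ((d 10).const_mul (1 / 10))).sub ((((((hasDerivAt_id u).const_mul 7776).sub
      ((d 2).const_mul 6048)).add ((d 3).const_mul 2240)).sub ((d 4).const_mul 392)).add
      ((d 5).const_mul (392 / 15)))).congr_deriv ?_
    norm_num
    ring
  have hmono := monotoneOn_of_hasDerivAt_nonneg (convex_Icc (x₀ - 6) x₀)
    (f := fun t => V t * ((t - (x₀ - 6)) * (6 - (t - (x₀ - 6)))) ^ 4
      - Y t * (4 * ((t - (x₀ - 6)) * (6 - (t - (x₀ - 6)))) ^ 3 * (6 - 2 * (t - (x₀ - 6))))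
      - P (t - (x₀ - 6)))
    (f' := fun t => (6 * Y t ^ 2 - t) * ((t - (x₀ - 6)) * (6 - (t - (x₀ - 6)))) ^ 4
      - Y t * (((t - (x₀ - 6)) * (6 - (t - (x₀ - 6)))) ^ 2 *
        (432 - 56 * ((t - (x₀ - 6)) * (6 - (t - (x₀ - 6))))))
      - ((t - (x₀ - 6)) ^ 4 * (6 - (t - (x₀ - 6))) ^ 5 -
        (432 - 56 * ((t - (x₀ - 6)) * (6 - (t - (x₀ - 6))))) ^ 2 / 24))
    (fun t ht => by
      obtain ⟨d1, d2⟩ := h t ht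
      have hu := (hasDerivAt_id t).sub_const (x₀ - 6)
      have hg := hu.mul (hu.const_sub 6)
      have hp := (hPd (t - (x₀ - 6))).comp t hu
      refine (((d2.mul (hg.pow 4)).sub (d1.mul (((hg.pow 3).const_mul 4).mul
        ((hu.const_mul 2).const_sub 6)))).sub hp).congr_deriv ?_
      simp only [id, Pi.mul_apply, Pi.pow_apply]
      norm_num
      ring)
    (fun t ht => by
      have hu : 0 ≤ t - (x₀ - 6) := by linarith [ht.1]
      have hu6 : 0 ≤ 6 - (t - (x₀ - 6)) := by linarith [ht.2]
      have ht' : 6 - (t - (x₀ - 6)) ≤ -t := by linarith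
      set u := t - (x₀ - 6)
      have e1 : (6 - u) * (u * (6 - u)) ^ 4 ≤ -t * (u * (6 - u)) ^ 4 := by gcongr
      nlinarith [sq_nonneg (12 * (Y t * (u * (6 - u)) ^ 2) - (432 - 56 * (u * (6 - u))))])
    (left_mem_Icc.2 (by linarith)) (right_mem_Icc.2 (by linarith)) (by linarith)
  simp only [hP] at hmono
  norm_num at hmono

lemma IsSol.le_barrier {q Y V : ℝ → ℝ} {α β x : ℝ} (h : IsSol q (Icc α β) Y V)
    (hq : ∀ t ∈ Icc α β, 0 ≤ q t) (hx : x ∈ Ioo α β) :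
    Y x ≤ 1 / (x - α) ^ 2 + 1 / (β - x) ^ 2 := by
  obtain ⟨B, hB⟩ := isCompact_Icc.exists_bound_of_continuousOn h.continuousOn
  have hB0 : 0 ≤ B := (norm_nonneg _).trans (hB x ⟨hx.1.le, hx.2.le⟩)
  have hxα := sub_pos.2 hx.1
  have hxβ := sub_pos.2 hx.2
  set η := min (min (x - α) (β - x)) (1 / (B + 1)) with hη
  have hη0 : 0 < η := by positivity
  have hη1 : η ≤ x - α := (min_le_left _ _).trans (min_le_left _ _)
  have hη2 : η ≤ β - x := (min_le_left _ _).trans (min_le_right _ _)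
  have hηB : B ≤ 1 / η ^ 2 := by
    have h1 : η ≤ 1 / (B + 1) := min_le_right _ _
    have h2 : B + 1 ≤ 1 / η := by
      rw [le_div_iff₀ (by positivity)] at h1 ⊢
      linarith
    have h3 : (B + 1) ^ 2 ≤ (1 / η) ^ 2 := by gcongr
    rw [div_pow, one_pow] at h3
    nlinarith
  have hd : ∀ t ∈ Icc (α + η) (β - η),
      HasDerivAt (fun t => Y t - (1 / (t - α) ^ 2 + 1 / (β - t) ^ 2))
        (V t - (-2 / (t - α) ^ 3 + 2 / (β - t) ^ 3)) t ∧
      HasDerivAt (fun t => V t - (-2 / (t - α) ^ 3 + 2 / (β - t) ^ 3))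
        (6 * Y t ^ 2 + q t - (6 / (t - α) ^ 4 + 6 / (β - t) ^ 4)) t := by
    intro t ht
    have h1 : t - α ≠ 0 := by linarith [ht.1]
    have h2 : β - t ≠ 0 := by linarith [ht.2]
    obtain ⟨d1, d2⟩ := h t ⟨by linarith [ht.1], by linarith [ht.2]⟩
    have u := (hasDerivAt_id t).sub_const α
    have v := (hasDerivAt_id t).const_sub β
    refine ⟨(d1.sub (((hasDerivAt_const t (1 : ℝ)).div (u.pow 2) (pow_ne_zero 2 h1)).add
      ((hasDerivAt_const t (1 : ℝ)).div (v.pow 2) (pow_ne_zero 2 h2)))).congr_deriv ?_,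
      (d2.sub (((hasDerivAt_const t (-2 : ℝ)).div (u.pow 3) (pow_ne_zero 3 h1)).add
      ((hasDerivAt_const t (2 : ℝ)).div (v.pow 3) (pow_ne_zero 3 h2)))).congr_deriv ?_⟩
    · simp only [id, Pi.pow_apply]
      norm_num
      field_simp
    · simp only [id, Pi.pow_apply]
      norm_num
      field_simp
      ring
  have := nonpos_of_deriv_le_of_pos (a := α + η) (b := β - η)
    (f := fun t => Y t - (1 / (t - α) ^ 2 + 1 / (β - t) ^ 2))
    (fun t ht => (hd t ht).1.continuousAt.continuousWithinAt)
    (fun t ht => (hd t (Ioo_subset_Icc_self ht)).1) ?_ ?_ ?_ x ⟨by linarith, by linarith⟩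
  · simpa using this
  · have h1 := (le_abs_self _).trans (hB (α + η) ⟨by linarith, by linarith⟩)
    have : 0 ≤ 1 / (β - (α + η)) ^ 2 := by positivity
    rw [add_sub_cancel_left]
    linarith
  · have h1 := (le_abs_self _).trans (hB (β - η) ⟨by linarith, by linarith⟩)
    have : 0 ≤ 1 / (β - η - α) ^ 2 := by positivity
    rw [sub_sub_cancel]
    linarith
  · intro l r hl hlr hr hpos
    have hs : Icc l r ⊆ Icc (α + η) (β - η) := Icc_subset_Icc hl.le hr.le
    refine monotoneOn_of_hasDerivAt_nonneg (convex_Icc l r) (fun t ht => (hd t (hs ht)).2)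
      (fun t ht => ?_) (left_mem_Icc.2 hlr) (right_mem_Icc.2 hlr) hlr
    have h1 := hpos t ht
    have h2 := hq t ⟨by linarith [(hs ht).1], by linarith [(hs ht).2]⟩
    have e1 : 6 / (t - α) ^ 4 = 6 * (1 / (t - α) ^ 2) ^ 2 := by
      rw [div_pow, one_pow, ← pow_mul, mul_one_div]
    have e2 : 6 / (β - t) ^ 4 = 6 * (1 / (β - t) ^ 2) ^ 2 := by
      rw [div_pow, one_pow, ← pow_mul, mul_one_div]
    have p1 : 0 ≤ 1 / (t - α) ^ 2 := by positivity
    have p2 : 0 ≤ 1 / (β - t) ^ 2 := by positivity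
    rw [e1, e2]
    have h3 : (1 / (t - α) ^ 2 + 1 / (β - t) ^ 2) ^ 2 ≤ Y t ^ 2 :=
      pow_le_pow_left₀ (by positivity) (by linarith) 2
    nlinarith [mul_nonneg p1 p2]

lemma IsSol.lower_bound_right {q Y V : ℝ → ℝ} {c δ M : ℝ} (hδ : 0 < δ)
    (h : IsSol q (Icc c (c + δ)) Y V) (hq : ∀ t ∈ Icc c (c + δ), 0 ≤ q t) (hV : 0 ≤ V c)
    (hM : Y (c + δ) ≤ M) : -max (2 * M) (5 / δ ^ 2) ≤ Y c := by
  by_contra! hcon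
  set L := -Y c with hL
  have hL1 : 2 * M < L := by linarith [le_max_left (2 * M) (5 / δ ^ 2)]
  have hL2 : 5 / δ ^ 2 < L := by linarith [le_max_right (2 * M) (5 / δ ^ 2)]
  have hL0 : 0 < L := lt_trans (by positivity) hL2
  have hVm := h.monotoneOn_deriv (convex_Icc _ _) hq
  have hl : c ∈ Icc c (c + δ) := ⟨le_rfl, by linarith⟩
  have hm : c + δ / 3 ∈ Icc c (c + δ) := ⟨by linarith, by linarith⟩
  have hYm := monotoneOn_of_hasDerivAt_nonneg (convex_Icc _ _) (fun t ht => (h t ht).1)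
    (fun t ht => hV.trans (hVm hl ht ht.1))
  have hsub1 : Icc c (c + δ / 3) ⊆ Icc c (c + δ) := Icc_subset_Icc_right (by linarith)
  have hsub2 : Icc (c + δ / 3) (c + δ) ⊆ Icc c (c + δ) := Icc_subset_Icc_left (by linarith)
  obtain ⟨ξ, hξ, hξ'⟩ := exists_hasDerivAt_eq_slope Y V (by linarith : c < c + δ / 3)
    (h.mono hsub1).continuousOn (fun t ht => (h t (hsub1 (Ioo_subset_Icc_self ht))).1)
  obtain ⟨ζ, hζ, hζ'⟩ := exists_hasDerivAt_eq_slope Y V (by linarith : c + δ / 3 < c + δ)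
    (h.mono hsub2).continuousOn (fun t ht => (h t (hsub2 (Ioo_subset_Icc_self ht))).1)
  obtain ⟨θ, hθ, hθ'⟩ := exists_hasDerivAt_eq_slope V (fun t => 6 * Y t ^ 2 + q t)
    (by linarith : c < c + δ / 3) (h.mono hsub1).continuousOn_deriv
    (fun t ht => (h t (hsub1 (Ioo_subset_Icc_self ht))).2)
  have hζm : c + δ / 3 ≤ ζ := hζ.1.le
  have hξζ := hVm (hsub1 ⟨hξ.1.le, hξ.2.le⟩) (hsub2 ⟨hζ.1.le, hζ.2.le⟩) (hξ.2.le.trans hζm)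
  have hmζ := hVm hm (hsub2 ⟨hζ.1.le, hζ.2.le⟩) hζm
  rw [eq_div_iff (by linarith)] at hξ' hζ' hθ'
  have hYhalf : Y (c + δ / 3) ≤ -(L / 2) := by
    by_contra! hc
    have h1 : Y (c + δ / 3) - Y c ≤ V ζ * (δ / 3) := by
      rw [← hξ']
      have : c + δ / 3 - c = δ / 3 := by ring
      rw [this]
      gcongr
    nlinarith
  have hθY : Y θ ≤ -(L / 2) := (hYm (hsub1 ⟨hθ.1.le, hθ.2.le⟩) hm hθ.2.le).trans hYhalf
  have hθ2 : 3 / 2 * L ^ 2 ≤ 6 * Y θ ^ 2 + q θ := by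
    have := hq θ (hsub1 ⟨hθ.1.le, hθ.2.le⟩)
    nlinarith
  have hVζ : L ^ 2 * δ / 2 ≤ V ζ := by nlinarith
  have hYc := hYm hl hm (by linarith)
  have hfin : L ^ 2 * δ ^ 2 / 3 ≤ 3 / 2 * L := by nlinarith
  rw [div_lt_iff₀ (by positivity)] at hL2
  nlinarith

lemma IsSol.abs_le_of_mem {q Y V : ℝ → ℝ} {α β δ x : ℝ} (hδ : 0 < δ)
    (h : IsSol q (Icc α β) Y V)
    (hq : ∀ t ∈ Icc α β, 0 ≤ q t) (hx : x ∈ Icc (α + 2 * δ) (β - 2 * δ)) :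
    |Y x| ≤ 5 / δ ^ 2 := by
  have hup : ∀ t ∈ Icc (α + δ) (β - δ), Y t ≤ 2 / δ ^ 2 := by
    intro t ht
    refine (h.le_barrier hq ⟨by linarith [ht.1], by linarith [ht.2]⟩).trans ?_
    have h1 : 1 / (t - α) ^ 2 ≤ 1 / δ ^ 2 := by gcongr; linarith [ht.1]
    have h2 : 1 / (β - t) ^ 2 ≤ 1 / δ ^ 2 := by gcongr; linarith [ht.2]
    calc _ ≤ 1 / δ ^ 2 + 1 / δ ^ 2 := add_le_add h1 h2
      _ = _ := by ring
  have h0 : 0 ≤ 1 / δ ^ 2 := by positivity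
  have e2 : 2 / δ ^ 2 = 2 * (1 / δ ^ 2) := by ring
  have e5 : 5 / δ ^ 2 = 5 * (1 / δ ^ 2) := by ring
  have hmax : max (2 * (2 / δ ^ 2)) (5 / δ ^ 2) = 5 / δ ^ 2 := max_eq_right (by linarith)
  refine abs_le.2 ⟨?_, (hup x ⟨by linarith [hx.1], by linarith [hx.2]⟩).trans (by linarith)⟩
  rw [← hmax]
  rcases le_total 0 (V x) with hV | hV
  · refine IsSol.lower_bound_right (q := q) hδ
      (h.mono (Icc_subset_Icc (by linarith [hx.1]) (by linarith [hx.2])))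
      (fun t ht => hq t ⟨by linarith [ht.1, hx.1], by linarith [ht.2, hx.2]⟩) hV
      (hup _ ⟨by linarith [hx.1], by linarith [hx.2]⟩)
  · have := IsSol.lower_bound_right (c := -x) hδ (h.reflect (J := Icc (-x) (-x + δ))
      (fun t ht => ⟨by linarith [ht.2, hx.1], by linarith [ht.1, hx.2]⟩))
      (fun t ht => hq (-t) ⟨by linarith [ht.2, hx.1], by linarith [ht.1, hx.2]⟩)
      (by simpa using hV) (hup (-(-x + δ)) ⟨by linarith [hx.1], by linarith [hx.2]⟩)
    simpa using this

lemma IsSol.abs_deriv_le_of_mem {q Y V : ℝ → ℝ} {α β δ x : ℝ} (hδ : 0 < δ)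
    (h : IsSol q (Icc α β) Y V)
    (hq : ∀ t ∈ Icc α β, 0 ≤ q t) (hx : x ∈ Icc (α + 3 * δ) (β - 3 * δ)) :
    |V x| ≤ 10 / δ ^ 3 := by
  have hVm := h.monotoneOn_deriv (convex_Icc _ _) hq
  have hsub : Icc (x - δ) (x + δ) ⊆ Icc α β :=
    Icc_subset_Icc (by linarith [hx.1]) (by linarith [hx.2])
  have hb : ∀ t ∈ Icc (x - δ) (x + δ), |Y t| ≤ 5 / δ ^ 2 := fun t ht =>
    h.abs_le_of_mem hδ hq ⟨by linarith [ht.1, hx.1], by linarith [ht.2, hx.2]⟩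
  have hsub1 : Icc (x - δ) x ⊆ Icc α β := (Icc_subset_Icc_right (by linarith)).trans hsub
  have hsub2 : Icc x (x + δ) ⊆ Icc α β := (Icc_subset_Icc_left (by linarith)).trans hsub
  obtain ⟨ξ, hξ, hξ'⟩ := exists_hasDerivAt_eq_slope Y V (by linarith : x - δ < x)
    (h.mono hsub1).continuousOn (fun t ht => (h t (hsub1 (Ioo_subset_Icc_self ht))).1)
  obtain ⟨ζ, hζ, hζ'⟩ := exists_hasDerivAt_eq_slope Y V (by linarith : x < x + δ)
    (h.mono hsub2).continuousOn (fun t ht => (h t (hsub2 (Ioo_subset_Icc_self ht))).1)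
  have hxm : x ∈ Icc α β := hsub1 ⟨by linarith, le_rfl⟩
  have h1 := hVm (hsub1 ⟨hξ.1.le, hξ.2.le⟩) hxm hξ.2.le
  have h2 := hVm hxm (hsub2 ⟨hζ.1.le, hζ.2.le⟩) hζ.1.le
  have b1 := abs_le.1 (hb (x - δ) ⟨le_rfl, by linarith⟩)
  have b2 := abs_le.1 (hb x ⟨by linarith, by linarith⟩)
  have b3 := abs_le.1 (hb (x + δ) ⟨by linarith, le_rfl⟩)
  have e : 10 / δ ^ 3 = (5 / δ ^ 2 + 5 / δ ^ 2) / δ := by field_simp; norm_num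
  rw [e]
  refine abs_le.2 ⟨le_trans ?_ h1, h2.trans ?_⟩
  · rw [hξ', sub_sub_cancel, ← neg_div]
    gcongr
    linarith
  · rw [hζ', add_sub_cancel_left]
    gcongr
    linarith

lemma exists_isSol_of_tendsto_initial {q : ℝ → ℝ} (hq : Continuous q) {y V : ℕ → ℝ → ℝ}
    {α β m N y₀ v₀ : ℝ} (hm : m ∈ Icc α β)
    (h : ∀ᶠ n in atTop, IsSol q (Icc α β) (y n) (V n) ∧ ∀ t ∈ Icc α β, |y n t| ≤ N)
    (hy : Tendsto (fun n => y n m) atTop (𝓝 y₀)) (hV : Tendsto (fun n => V n m) atTop (𝓝 v₀)) :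
    ∃ G W, IsSol q (Icc α β) G W ∧ ∀ t ∈ Icc α β,
      Tendsto (fun n => y n t) atTop (𝓝 (G t)) ∧ Tendsto (fun n => V n t) atTop (𝓝 (W t)) := by
  have hN : 0 ≤ N := by
    obtain ⟨n, -, hn⟩ := h.exists
    exact (abs_nonneg _).trans (hn m hm)
  obtain ⟨G, W, hG, hW, hGW⟩ := exists_trunc_solution hq (lo := fun _ => -N) continuous_const
    (M := N) (fun _ => by simp [abs_of_nonneg hN]) (a := α - 1) (b := β + 1) (t₀ := m)
    ⟨by linarith [hm.1], by linarith [hm.2]⟩ y₀ v₀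
  have hGW' : ∀ t ∈ Icc α β, _ := fun t ht =>
    hGW t ⟨by linarith [ht.1], by linarith [ht.2]⟩
  have key : ∀ t ∈ Icc α β,
      Tendsto (fun n => (y n t - G t) ^ 2 + (V n t - W t) ^ 2) atTop (𝓝 0) := by
    intro t ht
    have h0 : Tendsto (fun n => ((y n m - G m) ^ 2 + (V n m - W m) ^ 2) *
        Real.exp ((1 + 12 * N) * |t - m|)) atTop (𝓝 0) := by
      have := ((((hy.sub_const (G m)).pow 2).add ((hV.sub_const (W m)).pow 2)).mul_const
        (Real.exp ((1 + 12 * N) * |t - m|)))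
      simpa [hG, hW] using this
    refine squeeze_zero' (Eventually.of_forall fun n => by positivity) ?_ h0
    filter_upwards [h] with n hn
    exact hn.1.gronwall_trunc hn.2 hGW' hm ht
  have lim : ∀ t ∈ Icc α β,
      Tendsto (fun n => y n t) atTop (𝓝 (G t)) ∧ Tendsto (fun n => V n t) atTop (𝓝 (W t)) := by
    intro t ht
    have hs : Tendsto (fun n => √((y n t - G t) ^ 2 + (V n t - W t) ^ 2)) atTop (𝓝 0) := by
      simpa using (key t ht).sqrt
    constructor
    · rw [tendsto_iff_dist_tendsto_zero]
      refine squeeze_zero (fun _ => dist_nonneg) (fun n => ?_) hs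
      exact Real.abs_le_sqrt (by nlinarith [sq_nonneg (V n t - W t)])
    · rw [tendsto_iff_dist_tendsto_zero]
      refine squeeze_zero (fun _ => dist_nonneg) (fun n => ?_) hs
      exact Real.abs_le_sqrt (by nlinarith [sq_nonneg (y n t - G t)])
  refine ⟨G, W, fun t ht => ?_, lim⟩
  have hb : |G t| ≤ N :=
    le_of_tendsto (lim t ht).1.abs (h.mono fun n hn => hn.2 t ht)
  have hd := hGW' t ht
  rwa [trunc_eq_self (lo := fun _ => -N) (abs_le.1 hb).1 (abs_le.1 hb).2] at hd

lemma exists_isSol_Ioo_of_tendsto {q : ℝ → ℝ} (hq : Continuous q) {X T : ℝ} (hXT : X < T)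
    (hq0 : ∀ t ∈ Icc X T, 0 ≤ q t) {a : ℕ → ℝ} (ha : Tendsto a atTop (𝓝 X))
    {y V : ℕ → ℝ → ℝ} (h : ∀ n, IsSol q (Ioc (a n) T) (y n) (V n)) :
    ∃ Y W, IsSol q (Ioo X T) Y W := by
  have hsol : ∀ δ > 0, ∀ᶠ n in atTop, IsSol q (Icc (X + δ) T) (y n) (V n) := by
    intro δ hδ
    filter_upwards [ha.eventually_lt_const (by linarith : X < X + δ)] with n hn
    exact (h n).mono fun t ht => ⟨hn.trans_le ht.1, ht.2⟩
  have hq0' : ∀ δ > 0, ∀ t ∈ Icc (X + δ) T, 0 ≤ q t := fun δ hδ t ht =>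
    hq0 t ⟨by linarith [ht.1], ht.2⟩
  set m := (X + T) / 2 with hm
  obtain ⟨⟨y₀, v₀⟩, -, φ, hφ, hlim⟩ :=
    (((isCompact_Icc (a := -(5 / ((T - X) / 16) ^ 2)) (b := 5 / ((T - X) / 16) ^ 2)).prod
      (isCompact_Icc (a := -(10 / ((T - X) / 16) ^ 3)) (b := 10 / ((T - X) / 16) ^ 3))).tendsto_subseq'
      (x := fun n => (y n m, V n m)) (Eventually.frequently (by
        have hδ : 0 < (T - X) / 16 := by linarith
        filter_upwards [hsol _ hδ] with n hn
        exact ⟨abs_le.1 (hn.abs_le_of_mem hδ (hq0' _ hδ) ⟨by linarith, by linarith⟩),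
          abs_le.1 (hn.abs_deriv_le_of_mem hδ (hq0' _ hδ) ⟨by linarith, by linarith⟩)⟩)))
  have hl1 : Tendsto (fun n => y (φ n) m) atTop (𝓝 y₀) := (continuous_fst.tendsto _).comp hlim
  have hl2 : Tendsto (fun n => V (φ n) m) atTop (𝓝 v₀) := (continuous_snd.tendsto _).comp hlim
  refine ⟨fun x => limUnder atTop (fun n => y (φ n) x),
    fun x => limUnder atTop (fun n => V (φ n) x),
    fun x hx => ?_⟩
  obtain ⟨δ, hδ, h1, h2, h3⟩ : ∃ δ > 0, 4 * δ ≤ x - X ∧ 4 * δ ≤ T - x ∧ 8 * δ ≤ T - X := by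
    refine ⟨min (x - X) (T - x) / 8, ?_, ?_, ?_, ?_⟩
    · have := lt_min (sub_pos.2 hx.1) (sub_pos.2 hx.2)
      linarith
    all_goals linarith [min_le_left (x - X) (T - x), min_le_right (x - X) (T - x), hx.1, hx.2]
  obtain ⟨G, W, hGW, hlim'⟩ := exists_isSol_of_tendsto_initial (q := q) hq
    (y := fun n => y (φ n)) (V := fun n => V (φ n)) (α := X + 3 * δ) (β := T - 2 * δ)
    (N := 5 / δ ^ 2) (m := m) ⟨by linarith, by linarith⟩ (by
      filter_upwards [hφ.tendsto_atTop.eventually (hsol δ hδ)] with n hn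
      exact ⟨hn.mono (Icc_subset_Icc (by linarith) (by linarith)), fun t ht =>
        hn.abs_le_of_mem hδ (hq0' δ hδ) ⟨by linarith [ht.1], by linarith [ht.2]⟩⟩) hl1 hl2
  have hnhds : Icc (X + 3 * δ) (T - 2 * δ) ∈ 𝓝 x :=
    Icc_mem_nhds (by linarith) (by linarith)
  have hx' := mem_of_mem_nhds hnhds
  obtain ⟨d1, d2⟩ := hGW x hx'
  have e1 : (fun x => limUnder atTop (fun n => y (φ n) x)) =ᶠ[𝓝 x] G := by
    filter_upwards [hnhds] with t ht using (hlim' t ht).1.limUnder_eq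
  have e2 : (fun x => limUnder atTop (fun n => V (φ n) x)) =ᶠ[𝓝 x] W := by
    filter_upwards [hnhds] with t ht using (hlim' t ht).2.limUnder_eq
  refine ⟨(d1.congr_of_eventuallyEq e1).congr_deriv e2.eq_of_nhds.symm,
    (d2.congr_of_eventuallyEq e2).congr_deriv ?_⟩
  simp only [e1.eq_of_nhds]

/-- A solution regular at the right endpoint blows up on the left. -/
lemma exists_isSol_blowup_left {x₀ : ℝ} (hx₀ : x₀ ≤ 0) (y₀ v₀ : ℝ) :
    ∃ b ∈ Ico (x₀ - 6) x₀, ∃ Y V, Y x₀ = y₀ ∧ V x₀ = v₀ ∧ IsSol (fun x => -x) (Ioc b x₀) Y V ∧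
      Tendsto Y (𝓝[>] b) atTop := by
  rcases exists_isSol_or_blowup_left (q := fun x => -x) (by fun_prop)
    (by linarith : x₀ - 6 < x₀) (fun t ht => by linarith [ht.2]) y₀ v₀ with ⟨Y, V, -, -, h⟩ | h
  · exact absurd h (not_isSol_Icc_sub_six hx₀)
  · exact h

lemma IsSol.false_of_tendsto_nhdsGT {q Y V Z : ℝ → ℝ} {I : Set ℝ} {b c : ℝ} (hbc : b < c)
    (h : IsSol q I Y V) (hb : b ∈ I) (he : ∀ t ∈ Ioo b c, Z t = Y t)
    (hZ : Tendsto Z (𝓝[>] b) atTop) : False := by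
  refine not_tendsto_nhds_of_tendsto_atTop hZ (Y b) ?_
  refine Tendsto.congr' ?_ ((h b hb).1.continuousAt.tendsto.mono_left nhdsWithin_le_nhds)
  filter_upwards [Ioo_mem_nhdsGT hbc] with t ht using (he t ht).symm

lemma IsSol.false_of_tendsto_nhdsLT {q Y V Z : ℝ → ℝ} {I : Set ℝ} {b c : ℝ} (hbc : c < b)
    (h : IsSol q I Y V) (hb : b ∈ I) (he : ∀ t ∈ Ioo c b, Z t = Y t)
    (hZ : Tendsto Z (𝓝[<] b) atTop) : False := by
  refine not_tendsto_nhds_of_tendsto_atTop hZ (Y b) ?_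
  refine Tendsto.congr' ?_ ((h b hb).1.continuousAt.tendsto.mono_left nhdsWithin_le_nhds)
  filter_upwards [Ioo_mem_nhdsLT hbc] with t ht using (he t ht).symm

/-- The left blow-up points of the solutions of `y'' = 6 y ^ 2 - x` that are regular at `x₀`. -/
def blowupPoints (x₀ : ℝ) : Set ℝ :=
  {a | ∃ y V, a < x₀ ∧ IsSol (fun x => -x) (Ioc a x₀) y V ∧ Tendsto y (𝓝[>] a) atTop}

lemma blowupPoints_nonempty {x₀ : ℝ} (hx₀ : x₀ ≤ 0) : (blowupPoints x₀).Nonempty := by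
  obtain ⟨b, hb, Y, V, -, -, h, ht⟩ := exists_isSol_blowup_left hx₀ 0 0
  exact ⟨b, Y, V, hb.2, h, ht⟩

lemma bddBelow_blowupPoints {x₀ : ℝ} (hx₀ : x₀ ≤ 0) : BddBelow (blowupPoints x₀) := by
  refine ⟨x₀ - 6, ?_⟩
  rintro a ⟨y, V, -, h, -⟩
  by_contra! hlt
  exact not_isSol_Icc_sub_six hx₀ (h.mono fun t ht => ⟨hlt.trans_le ht.1, ht.2⟩)

lemma sInf_blowupPoints_lt {x₀ : ℝ} (hx₀ : x₀ ≤ 0) : sInf (blowupPoints x₀) < x₀ := by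
  obtain ⟨a, ha⟩ := blowupPoints_nonempty hx₀
  obtain ⟨_, _, hlt, _⟩ := id ha
  exact (csInf_le (bddBelow_blowupPoints hx₀) ha).trans_lt hlt

lemma not_isSol_Icc_sInf {x₀ : ℝ} (hx₀ : x₀ ≤ 0) {Y V : ℝ → ℝ} :
    ¬ IsSol (fun x => -x) (Icc (sInf (blowupPoints x₀)) x₀) Y V := by
  intro h
  obtain ⟨b, hb, Z, W, hZ, hW, h', ht⟩ := exists_isSol_blowup_left hx₀ (Y x₀) (V x₀)
  have hXb : sInf (blowupPoints x₀) ≤ b :=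
    csInf_le (bddBelow_blowupPoints hx₀) ⟨Z, W, hb.2, h', ht⟩
  refine h.false_of_tendsto_nhdsGT hb.2 ⟨hXb, hb.2.le⟩ (fun t ht => ?_) ht
  exact (h'.eq_of_eq (h.mono fun s hs => ⟨hXb.trans hs.1.le, hs.2⟩) ⟨hb.2, le_rfl⟩
    ⟨ht.1, ht.2.le⟩ hZ hW).1

lemma exists_isSol_Ioo_sInf {x₀ : ℝ} (hx₀ : x₀ ≤ 0) :
    ∃ y V, IsSol (fun x => -x) (Ioo (sInf (blowupPoints x₀)) x₀) y V := by
  obtain ⟨a, -, ha, haA⟩ :=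
    exists_seq_tendsto_sInf (blowupPoints_nonempty hx₀) (bddBelow_blowupPoints hx₀)
  choose y V _ h _ using haA
  exact exists_isSol_Ioo_of_tendsto (by fun_prop) (sInf_blowupPoints_lt hx₀)
    (fun t ht => by linarith [ht.2]) ha h

/-- A solution on `(X, x₀)`, with `X` the infimum of the left blow-up points, has a pole at
`x₀`. -/
lemma IsSol.tendsto_nhdsLT_of_sInf {x₀ : ℝ} (hx₀ : x₀ ≤ 0) {y V : ℝ → ℝ}
    (h : IsSol (fun x => -x) (Ioo (sInf (blowupPoints x₀)) x₀) y V) :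
    Tendsto y (𝓝[<] x₀) atTop := by
  set X := sInf (blowupPoints x₀) with hX
  have hlt : X < x₀ := sInf_blowupPoints_lt hx₀
  obtain ⟨c, hXc, hcx⟩ := exists_between hlt
  rcases exists_isSol_or_blowup_right (q := fun x => -x) (by fun_prop) hcx
    (fun t ht => by linarith [ht.2]) (y c) (V c) with
    ⟨Y, W, hY, hW, h'⟩ | ⟨b, hb, Y, W, hY, hW, h', ht⟩
  · exfalso
    have hYy : ∀ t ∈ Ico c x₀, Y t = y t ∧ W t = V t := fun t ht =>
      (h'.mono Ico_subset_Icc_self).eq_of_eq (h.mono fun s hs => ⟨hXc.trans_le hs.1, hs.2⟩)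
        ⟨le_rfl, hcx⟩ ht hY hW
    obtain ⟨b, hb, Z, U, hZ, hU, h'', ht⟩ := exists_isSol_blowup_left hx₀ (Y x₀) (W x₀)
    have hXb : X ≤ b := csInf_le (bddBelow_blowupPoints hx₀) ⟨Z, U, hb.2, h'', ht⟩
    obtain ⟨d, hd, hdx⟩ := exists_between (max_lt hcx hb.2)
    obtain ⟨hcd, hbd⟩ := max_lt_iff.1 hd
    have hZd : Z d = Y d ∧ U d = W d :=
      (h''.mono (J := Icc d x₀) fun s hs => ⟨hbd.trans_le hs.1, hs.2⟩).eq_of_eq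
        (h'.mono fun s hs => ⟨hcd.le.trans hs.1, hs.2⟩) ⟨hdx.le, le_rfl⟩ ⟨le_rfl, hdx.le⟩ hZ hU
    have hYd := hYy d ⟨hcd.le, hdx⟩
    have hZy : ∀ t ∈ Ioo b x₀, Z t = y t := fun t ht =>
      ((h''.mono Ioo_subset_Ioc_self).eq_of_eq (h.mono (Ioo_subset_Ioo_left hXb)) ⟨hbd, hdx⟩ ht
        (hZd.1.trans hYd.1) (hZd.2.trans hYd.2)).1
    rcases hXb.eq_or_lt with rfl | hXb
    · obtain ⟨_, _, hbad⟩ := h''.exists_isSol_of_pole_left (by fun_prop) hb.2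
        (fun t ht => by linarith [ht.2]) ht
      exact not_isSol_Icc_sInf hx₀ hbad
    · exact h.false_of_tendsto_nhdsGT hb.2 ⟨hXb, hb.2⟩ hZy ht
  · have hYy : ∀ t ∈ Ico c b, Y t = y t := fun t ht =>
      (h'.eq_of_eq (h.mono fun s hs => ⟨hXc.trans_le hs.1, hs.2.trans_le hb.2⟩)
        ⟨le_rfl, hb.1⟩ ht hY hW).1
    rcases hb.2.eq_or_lt with rfl | hbx
    · refine ht.congr' ?_
      filter_upwards [Ioo_mem_nhdsLT hb.1] with t ht using hYy t ⟨ht.1.le, ht.2⟩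
    · exact (h.false_of_tendsto_nhdsLT hb.1 ⟨hXc.trans hb.1, hbx⟩
        (fun t ht => hYy t ⟨ht.1.le, ht.2⟩) ht).elim

/-- A solution on `(X, x₀)`, with `X` the infimum of the left blow-up points, has a pole at
`X`. -/
lemma IsSol.tendsto_nhdsGT_of_sInf {x₀ : ℝ} (hx₀ : x₀ ≤ 0) {y V : ℝ → ℝ}
    (h : IsSol (fun x => -x) (Ioo (sInf (blowupPoints x₀)) x₀) y V) :
    Tendsto y (𝓝[>] (sInf (blowupPoints x₀))) atTop := by
  set X := sInf (blowupPoints x₀) with hX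
  have hlt : X < x₀ := sInf_blowupPoints_lt hx₀
  obtain ⟨c, hXc, hcx⟩ := exists_between hlt
  rcases exists_isSol_or_blowup_left (q := fun x => -x) (by fun_prop) hXc
    (fun t ht => by linarith [ht.2]) (y c) (V c) with
    ⟨Y, W, hY, hW, h'⟩ | ⟨b, hb, Y, W, hY, hW, h', ht⟩
  · exfalso
    have hYc : ∀ t ∈ Ioc X c, Y t = y t ∧ W t = V t := fun t ht =>
      (h'.mono Ioc_subset_Icc_self).eq_of_eq (h.mono fun s hs => ⟨hs.1, hs.2.trans_lt hcx⟩)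
        ⟨hXc, le_rfl⟩ ht hY hW
    rcases exists_isSol_or_blowup_right (q := fun x => -x) (by fun_prop) hlt
      (fun t ht => by linarith [ht.2]) (Y X) (W X) with
      ⟨Z, U, hZ, hU, h''⟩ | ⟨b, hb, Z, U, hZ, hU, h'', ht⟩
    · exact not_isSol_Icc_sInf hx₀ h''
    · obtain ⟨d, hXd, hd⟩ := exists_between (lt_min hXc hb.1)
      obtain ⟨hdc, hdb⟩ := lt_min_iff.1 hd
      have hZd : Z d = Y d ∧ U d = W d :=
        (h''.mono (J := Icc X d) fun s hs => ⟨hs.1, hs.2.trans_lt hdb⟩).eq_of_eq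
          (h'.mono fun s hs => ⟨hs.1, hs.2.trans hdc.le⟩) ⟨le_rfl, hXd.le⟩ ⟨hXd.le, le_rfl⟩ hZ hU
      have hYd := hYc d ⟨hXd, hdc.le⟩
      have hZy : ∀ t ∈ Ioo X b, Z t = y t := fun t ht =>
        ((h''.mono Ioo_subset_Ico_self).eq_of_eq (h.mono (Ioo_subset_Ioo_right hb.2)) ⟨hXd, hdb⟩ ht
          (hZd.1.trans hYd.1) (hZd.2.trans hYd.2)).1
      rcases hb.2.eq_or_lt with rfl | hbx
      · obtain ⟨_, _, hbad⟩ := h''.exists_isSol_of_pole_right (by fun_prop) hb.1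
          (fun t ht => by linarith [ht.2]) ht
        exact not_isSol_Icc_sInf hx₀ hbad
      · exact h.false_of_tendsto_nhdsLT hb.1 ⟨hb.1, hbx⟩ hZy ht
  · have hYy : ∀ t ∈ Ioc b c, Y t = y t := fun t ht =>
      (h'.eq_of_eq (h.mono fun s hs => ⟨hb.1.trans_lt hs.1, hs.2.trans_lt hcx⟩)
        ⟨hb.2, le_rfl⟩ ht hY hW).1
    rcases hb.1.eq_or_lt with hXb | hXb
    · rw [hXb]
      refine ht.congr' ?_
      filter_upwards [Ioo_mem_nhdsGT hb.2] with t ht using hYy t ⟨ht.1, ht.2.le⟩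
    · exact (h.false_of_tendsto_nhdsGT hb.2 ⟨hXb, hb.2.trans hcx⟩
        (fun t ht => hYy t ⟨ht.1, ht.2.le⟩) ht).elim

end PainleveI

/-- For any `x₀ ≤ 0` there exists a unique real solution of `y'' = 6y² - x`
whose interval of existence is exactly `(X(x₀), x₀)`, where
`X(x₀) = sInf A` is the infimum of left blow-up points over all solutions
regular at `x₀`. -/
theorem painleveI_maximal_solution_exists_unique (x₀ : ℝ) (hx₀ : x₀ ≤ 0)
    (A : Set ℝ)
    (hA : A = {a : ℝ | ∃ y y' : ℝ → ℝ, a < x₀ ∧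
      (∀ x ∈ Set.Ioc a x₀,
        HasDerivAt y (y' x) x ∧ HasDerivAt y' (6 * (y x) ^ 2 - x) x) ∧
      Tendsto y (𝓝[>] a) atTop}) :
    (∃ y y' : ℝ → ℝ,
      (∀ x ∈ Set.Ioo (sInf A) x₀,
        HasDerivAt y (y' x) x ∧ HasDerivAt y' (6 * (y x) ^ 2 - x) x) ∧
      Tendsto y (𝓝[>] (sInf A)) atTop ∧ Tendsto y (𝓝[<] x₀) atTop) ∧
    (∀ y y' z z' : ℝ → ℝ,
      ((∀ x ∈ Set.Ioo (sInf A) x₀,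
        HasDerivAt y (y' x) x ∧ HasDerivAt y' (6 * (y x) ^ 2 - x) x) ∧
        Tendsto y (𝓝[>] (sInf A)) atTop ∧ Tendsto y (𝓝[<] x₀) atTop) →
      ((∀ x ∈ Set.Ioo (sInf A) x₀,
        HasDerivAt z (z' x) x ∧ HasDerivAt z' (6 * (z x) ^ 2 - x) x) ∧
        Tendsto z (𝓝[>] (sInf A)) atTop ∧ Tendsto z (𝓝[<] x₀) atTop) →
      ∀ x ∈ Set.Ioo (sInf A) x₀, y x = z x) := by
  obtain rfl : A = PainleveI.blowupPoints x₀ := hA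
  refine ⟨?_, ?_⟩
  · obtain ⟨y, V, h⟩ := PainleveI.exists_isSol_Ioo_sInf hx₀
    exact ⟨y, V, h, h.tendsto_nhdsGT_of_sInf hx₀, h.tendsto_nhdsLT_of_sInf hx₀⟩
  · rintro y y' z z' ⟨hy, hy1, hy2⟩ ⟨hz, hz1, hz2⟩ x hx
    by_contra hne
    obtain ⟨_, _, h⟩ := PainleveI.IsSol.exists_isSol_of_two_poles (q := fun x => -x) (by fun_prop)
      (fun t ht => by linarith [ht.2]) hy hz hy1 hz1 hy2 hz2 hx hne
    exact PainleveI.not_isSol_Icc_sInf hx₀ h
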